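/- For every real number b there exists a constant C > 0 such that for every ε > 0 and all sufficiently large k (depending on ε) there exists m ≤ C·k with the following property. Let H be the graph H_{k,m} (the disjoint union of 2k trees with centers v₁, w₁, …, v_k, w_k, where each tree consists of its center adjacent to 2m middle vertices, and each middle vertex additionally adjacent to two pendant vertices). Equip H with edge weights that are independent random variables, each uniform on [b, b+1], and let σ be a uniformly random cut of H, independent of the weights. Then with probability at least 1 − ε there exists a 3-flip sequence L that is improving from σ, moves no center vertex v_i or w_i, and satisfies |impr_{σ^L}(u) − 3^{−(i−1)}| < 3^{−k} for all i ∈ [k] and u ∈ {v_i, w_i}. -/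

import Mathlib

open Finset
open scoped Classical

namespace MaxCut

variable {V : Type*} [Fintype V]

/-- The value of a cut `σ` in graph `G` with weights `X`. -/
noncomputable def cutValue (G : SimpleGraph V) (X : Sym2 V → ℝ) (σ : V → ℝ) : ℝ :=
  (1 / 2) * ∑ e ∈ Finset.univ.filter (fun e => e ∈ G.edgeSet),
    (1 - Sym2.lift ⟨fun u w => σ u * σ w, fun u w => by ring⟩ e) * X e

/-- Flip the vertices of `S` across the cut. -/
noncomputable def flip (σ : V → ℝ) (S : Finset V) : V → ℝ := fun v => if v ∈ S then -σ v else σ v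

/-- The change in cut value caused by flipping all vertices of `S`. -/
noncomputable def impr (G : SimpleGraph V) (X : Sym2 V → ℝ) (σ : V → ℝ) (S : Finset V) : ℝ :=
  cutValue G X (flip σ S) - cutValue G X σ

/-- The cut obtained from `σ` by performing all moves of the flip sequence. -/
noncomputable def applyList (σ : V → ℝ) : List (Finset V) → (V → ℝ)
  | [] => σ
  | S :: L => applyList (flip σ S) L

/-- A flip sequence is improving from `σ` if each step strictly increases the cut value. -/
def Improving (G : SimpleGraph V) (X : Sym2 V → ℝ) : (V → ℝ) → List (Finset V) → Prop
  | _, [] => True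
  | σ, S :: L => 0 < impr G X σ S ∧ Improving G X (flip σ S) L

/-- A cut assigns `1` or `-1` to each vertex. -/
def IsCut (σ : V → ℝ) : Prop := ∀ v, σ v = 1 ∨ σ v = -1

/-- A local optimum: no single-vertex flip is improving. -/
noncomputable def deg (G : SimpleGraph V) (v : V) : ℕ :=
  (Finset.univ.filter (fun u => G.Adj v u)).card

def IsLocalOpt (G : SimpleGraph V) (X : Sym2 V → ℝ) (σ : V → ℝ) : Prop :=
  ∀ v : V, impr G X σ {v} ≤ 0


open MeasureTheory ProbabilityTheory

/-- The uniform probability measure on the interval `[a, b]`. -/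
noncomputable def uniformIcc (a b : ℝ) : Measure ℝ :=
  (volume (Set.Icc a b))⁻¹ • volume.restrict (Set.Icc a b)

/-- Convert a boolean colouring into a `±1`-valued cut. -/
noncomputable def toCut {V : Type*} (f : V → Bool) : V → ℝ := fun v => if f v then 1 else -1

/-- Vertices of one tree `S^{v_i}` (resp. `S^{w_i}`): a center, `2m` middle vertices, and two
pendant vertices attached to each middle vertex. -/
abbrev TreeV (m : ℕ) := Unit ⊕ (Fin (2 * m) ⊕ (Fin (2 * m) × Fin 2))

/-- Adjacency inside one tree: the center is adjacent to each middle vertex, and the middle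
vertex `j` is adjacent to its two pendants. -/
def treeRel (m : ℕ) : TreeV m → TreeV m → Prop := fun x y =>
  (∃ j : Fin (2 * m), x = Sum.inl () ∧ y = Sum.inr (Sum.inl j)) ∨
  (∃ (j : Fin (2 * m)) (t : Fin 2), x = Sum.inr (Sum.inl j) ∧ y = Sum.inr (Sum.inr (j, t)))

/-- The vertex set of `H_{k,m}`: `2k` disjoint copies of the tree. -/
abbrev HV (k m : ℕ) := Fin k × Fin 2 × TreeV m

/-- The graph `H_{k,m}`: the disjoint union of the `2k` trees. -/
def HGraph (k m : ℕ) : SimpleGraph (HV k m) :=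
  SimpleGraph.fromRel (fun x y => x.1 = y.1 ∧ x.2.1 = y.2.1 ∧ treeRel m x.2.2 y.2.2)

/-- The center of the tree `S^{v_i}` (for `s = 0`) resp. `S^{w_i}` (for `s = 1`). -/
def center (k m : ℕ) (i : Fin k) (s : Fin 2) : HV k m := (i, s, Sum.inl ())

-- BEGIN P1
/-- one step of the reachable set -/
def stp (w : ℝ) (R : Set ℝ) (x : ℝ) : Set ℝ := R ∪ ({z | z - x ∈ R} ∩ Set.Icc (-w) w)

def reach (w η : ℝ) : (n : ℕ) → (Fin n → ℝ) → Set ℝ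
  | 0, _ => Set.Icc (-η) η
  | n + 1, d => stp w (reach w η n (fun j => d j.succ)) (d 0)

lemma reach_sub {w η : ℝ} (h : η ≤ w) : ∀ (n : ℕ) (d : Fin n → ℝ), reach w η n d ⊆ Set.Icc (-w) w
  | 0, _ => Set.Icc_subset_Icc (by linarith) h
  | n + 1, d => Set.union_subset (reach_sub h n _) Set.inter_subset_right

lemma sub_reach {w η : ℝ} : ∀ (n : ℕ) (d : Fin n → ℝ), Set.Icc (-η) η ⊆ reach w η n d
  | 0, _ => le_refl _
  | n + 1, d => (sub_reach n _).trans Set.subset_union_left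

lemma reach_sound {w η : ℝ} : ∀ (n : ℕ) (d : Fin n → ℝ) (z : ℝ), z ∈ reach w η n d →
    ∃ S : Finset (Fin n), |z - ∑ j ∈ S, d j| ≤ η
  | 0, _, z, hz => ⟨∅, by
    have hz' : z ∈ Set.Icc (-η) η := hz
    simpa [abs_le] using hz'⟩
  | n + 1, d, z, hz => by
    rcases hz with hz | hz
    · obtain ⟨S, hS⟩ := reach_sound n _ z hz
      exact ⟨S.map (Fin.succEmb n), by simpa using hS⟩
    · obtain ⟨S, hS⟩ := reach_sound n _ _ hz.1
      refine ⟨insert 0 (S.map (Fin.succEmb n)), ?_⟩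
      rw [Finset.sum_insert (by simp [Fin.succ_ne_zero])]
      simpa [sub_sub] using hS

lemma reach_meas {w η : ℝ} : ∀ (n : ℕ),
    MeasurableSet {p : (Fin n → ℝ) × ℝ | p.2 ∈ reach w η n p.1}
  | 0 => by
    have : {p : (Fin 0 → ℝ) × ℝ | p.2 ∈ reach w η 0 p.1} = Prod.snd ⁻¹' Set.Icc (-η) η := rfl
    rw [this]; exact measurable_snd measurableSet_Icc
  | n + 1 => by
    have ih := reach_meas (w := w) (η := η) n
    have : {p : (Fin (n+1) → ℝ) × ℝ | p.2 ∈ reach w η (n+1) p.1} =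
      ((fun p : (Fin (n+1) → ℝ) × ℝ => ((fun j => p.1 j.succ : Fin n → ℝ), p.2)) ⁻¹' 
        {p : (Fin n → ℝ) × ℝ | p.2 ∈ reach w η n p.1}) ∪
      ((fun p : (Fin (n+1) → ℝ) × ℝ => ((fun j => p.1 j.succ : Fin n → ℝ), p.2 - p.1 0)) ⁻¹' 
        {p : (Fin n → ℝ) × ℝ | p.2 ∈ reach w η n p.1} ∩ Prod.snd ⁻¹' Set.Icc (-w) w) := rfl
    rw [this]
    refine (MeasurableSet.preimage ih (by fun_prop)).union
      ((MeasurableSet.preimage ih (by fun_prop)).inter (measurable_snd measurableSet_Icc))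

lemma reach_vol_meas {w η : ℝ} (n : ℕ) :
    Measurable (fun d : Fin n → ℝ => volume.real (reach w η n d)) :=
  (measurable_measure_prodMk_left (reach_meas n)).ennreal_toReal

lemma reach_meas' {w η : ℝ} (n : ℕ) (d : Fin n → ℝ) : MeasurableSet (reach w η n d) :=
  measurable_prodMk_left (reach_meas n)

lemma stp_integral {w c0 : ℝ} (hw : 0 < w) (hc : 0 < c0) (μ : Measure ℝ) [IsProbabilityMeasure μ]
    (hμ : ∀ E : Set ℝ, MeasurableSet E → E ⊆ Set.Icc (-(2*w)) (2*w) →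
      ENNReal.ofReal c0 * volume E ≤ μ E)
    (R : Set ℝ) (hR : MeasurableSet R) (hRW : R ⊆ Set.Icc (-w) w) (hv : 0 < volume.real R) :
    ∫ x, (1 / volume.real (stp w R x) - 1 / (2*w)) ∂μ ≤
      (1 - c0 * w) * (1 / volume.real R - 1 / (2*w)) := by
  set v := volume.real R with hvdef
  have hWfin : volume (Set.Icc (-w) w) ≠ ⊤ := by simp
  have hRfin : volume R ≠ ⊤ := ne_top_of_le_ne_top hWfin (measure_mono hRW)
  set W := Set.Icc (-w) w with hW
  set Q : Set (ℝ × ℝ) := {p | p.2 ∈ W \ R ∧ p.2 - p.1 ∈ R} with hQ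
  have hQm : MeasurableSet Q := by
    apply MeasurableSet.inter
    · exact measurable_snd (measurableSet_Icc.diff hR)
    · exact (measurable_snd.sub measurable_fst) hR
  set Δ : ℝ → ℝ := fun x => volume.real (Prod.mk x ⁻¹' Q) with hΔ
  have hfin : ∀ x, volume (Prod.mk x ⁻¹' Q) ≠ ⊤ := fun x =>
    ne_top_of_le_ne_top hWfin (measure_mono (fun z hz => hz.1.1))
  have hΔm : Measurable Δ := (measurable_measure_prodMk_left hQm).ennreal_toReal
  have hΔ0 : ∀ x, 0 ≤ Δ x := fun x => measureReal_nonneg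
  have hΔv : ∀ x, Δ x ≤ v := by
    intro x
    have h1 : volume ((fun z => z - x) ⁻¹' R) = volume R := by
      simpa [sub_eq_add_neg] using measure_preimage_add_right volume (-x) R
    rw [hvdef, measureReal_def, ← h1]
    apply ENNReal.toReal_mono (by rw [h1]; exact hRfin)
    exact measure_mono (fun z hz => hz.2)
  have hstep : ∀ x, volume.real (stp w R x) = v + Δ x := by
    intro x
    have : stp w R x = R ∪ (Prod.mk x ⁻¹' Q) := by
      ext z
      simp only [stp, hQ, Set.mem_union, Set.mem_inter_iff, Set.mem_ofPred_eq, Set.mem_preimage,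
        Set.mem_sdiff]
      tauto
    rw [this, measureReal_union _ (measurable_prodMk_left hQm) hRfin (hfin x)]
    rw [Set.disjoint_left]
    intro z hz hz'
    exact hz'.1.2 hz
  have hWv : volume.real W = 2 * w := by
    simp [hW, Real.volume_real_Icc]; rw [max_eq_left] <;> linarith
  have hWR : volume.real (W \ R) = 2 * w - v := by
    rw [measureReal_sdiff hRW hR, hWv]
  have hvw : v ≤ 2 * w := by
    rw [← hWv]; exact measureReal_mono hRW
  -- lower bound on expected growth
  have hint : c0 * v * (2 * w - v) ≤ ∫ x, Δ x ∂μ := by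
    have h1 : ∫ x, Δ x ∂μ = ((μ.prod volume) Q).toReal := by
      rw [Measure.prod_apply hQm, hΔ]
      simp only [measureReal_def]
      rw [integral_toReal (measurable_measure_prodMk_left hQm).aemeasurable]
      exact Filter.Eventually.of_forall fun x => (hfin x).lt_top
    have h2 : ENNReal.ofReal c0 * volume R * volume (W \ R) ≤ (μ.prod volume) Q := by
      rw [Measure.prod_apply_symm hQm]
      calc ENNReal.ofReal c0 * volume R * volume (W \ R) 
          = ∫⁻ z in W \ R, ENNReal.ofReal c0 * volume R := by simp
        _ ≤ ∫⁻ z in W \ R, μ ((fun x => (x, z)) ⁻¹' Q) := by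
          apply setLIntegral_mono' (measurableSet_Icc.diff hR)
          intro z hz
          have e1 : (fun x => (x, z)) ⁻¹' Q = (fun x => z - x) ⁻¹' R := by
            ext x; simp only [hQ, Set.mem_preimage, Set.mem_ofPred_eq]; tauto
          have e2 : volume ((fun x => z - x) ⁻¹' R) = volume R := 
            (Measure.measurePreserving_sub_left volume z).measure_preimage hR.nullMeasurableSet
          rw [e1, ← e2]
          apply hμ
          · exact (measurable_const.sub measurable_id) hR
          · intro x hx
            have a1 := hRW hx
            have a2 := hz.1
            simp only [hW, Set.mem_Icc] at a1 a2 ⊢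
            constructor <;> linarith
        _ ≤ ∫⁻ z, μ ((fun x => (x, z)) ⁻¹' Q) := setLIntegral_le_lintegral _ _
    have hQfin : (μ.prod volume) Q ≠ ⊤ := by
      refine ne_top_of_le_ne_top (b := (μ.prod volume) (Set.univ ×ˢ W)) ?_ 
        (measure_mono (fun p hp => ⟨trivial, hp.1.1⟩))
      rw [Measure.prod_prod]; simpa using hWfin
    rw [h1]
    have := ENNReal.toReal_mono hQfin h2
    rw [ENNReal.toReal_mul, ENNReal.toReal_mul, ENNReal.toReal_ofReal hc.le] at this
    rw [← hWR]; exact this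
  have hΔi : Integrable Δ μ := by
    refine Integrable.of_bound hΔm.aestronglyMeasurable v (Filter.Eventually.of_forall fun x => ?_)
    rw [Real.norm_eq_abs, abs_of_nonneg (hΔ0 x)]; exact hΔv x
  have hle : ∫ x, (1 / volume.real (stp w R x) - 1 / (2*w)) ∂μ ≤
      ∫ x, ((1 / v - 1 / (2 * w)) - (1 / (2 * v^2)) * Δ x) ∂μ := by
    apply integral_mono_of_nonneg
    · refine Filter.Eventually.of_forall fun x => ?_
      simp only [Pi.zero_apply, sub_nonneg]
      apply one_div_le_one_div_of_le
      · rw [hstep]; linarith [hΔ0 x]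
      · rw [← hWv]
        exact measureReal_mono (Set.union_subset hRW Set.inter_subset_right) 
    · exact (integrable_const _).sub (hΔi.const_mul _)
    · refine Filter.Eventually.of_forall fun x => ?_
      simp only [hstep]
      have a := hΔ0 x
      have b := hΔv x
      have : 1 / (v + Δ x) ≤ 1 / v - 1 / (2 * v^2) * Δ x := by
        rw [div_le_iff₀ (by linarith)]
        have : (1 / v - 1 / (2 * v^2) * Δ x) * (v + Δ x) = 1 + Δ x * (v - Δ x) / (2 * v^2) := by
          field_simp; ring
        rw [this]
        have : 0 ≤ Δ x * (v - Δ x) / (2 * v^2) := by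
          apply div_nonneg (mul_nonneg a (by linarith)) (by positivity)
        linarith
      linarith
  refine hle.trans ?_
  rw [integral_sub (integrable_const _) (hΔi.const_mul _), integral_const_mul]
  simp only [integral_const, probReal_univ, smul_eq_mul]
  have h3 : 1 / (2 * v^2) * (c0 * v * (2 * w - v)) ≤ 1 / (2 * v^2) * ∫ x, Δ x ∂μ :=
    mul_le_mul_of_nonneg_left hint (by positivity)
  have h4 : 1 / (2 * v^2) * (c0 * v * (2 * w - v)) = c0 * w * (1 / v - 1 / (2*w)) := by
    field_simp
  rw [h4] at h3
  linarith

lemma lueker_int {w c0 η : ℝ} (hw : 0 < w) (hc : 0 < c0) (hcw : c0 * w ≤ 1) 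
    (hη : 0 < η) (hηw : η ≤ w) :
    ∀ (n : ℕ) (μ : Fin n → Measure ℝ) [∀ i, IsProbabilityMeasure (μ i)]
    (_ : ∀ i, ∀ E : Set ℝ, MeasurableSet E → E ⊆ Set.Icc (-(2*w)) (2*w) →
      ENNReal.ofReal c0 * volume E ≤ μ i E),
    ∫ d, (1 / volume.real (reach w η n d) - 1 / (2*w)) ∂(Measure.pi μ) ≤
      (1 - c0 * w) ^ n * (1 / (2 * η) - 1 / (2*w))
  | 0, μ, _, _ => by
    simp only [reach, pow_zero, one_mul, integral_const, probReal_univ,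
      smul_eq_mul, Real.volume_real_Icc]
    rw [max_eq_left (by linarith)]
    apply le_of_eq; ring_nf
  | n + 1, μ, _, hμ => by
    have ih := lueker_int hw hc hcw hη hηw n (fun j => μ j.succ) (fun j => hμ j.succ)
    have hb : ∀ (n : ℕ) (d : Fin n → ℝ), 
        |1 / volume.real (reach w η n d) - 1 / (2*w)| ≤ 1 / (2 * η) := by
      intro n d
      have h1 : 2 * η ≤ volume.real (reach w η n d) := by
        have := measureReal_mono (μ := volume) (sub_reach (w := w) (η := η) n d) 
          (ne_top_of_le_ne_top (by simp) (measure_mono (reach_sub hηw n d)))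
        rw [Real.volume_real_Icc, max_eq_left (by linarith)] at this
        linarith
      have h2 : volume.real (reach w η n d) ≤ 2 * w := by
        have := measureReal_mono (μ := volume) (reach_sub hηw n d) (by simp)
        rw [Real.volume_real_Icc, max_eq_left (by linarith)] at this
        linarith
      have h3 := one_div_le_one_div_of_le (by linarith) h1
      have h4 := one_div_le_one_div_of_le (by linarith) h2
      have h5 : 0 < 1 / (2 * w) := by positivity
      rw [abs_of_nonneg] <;> linarith
    have mp := measurePreserving_piFinSuccAbove μ 0
    set F : ℝ × (Fin n → ℝ) → ℝ := fun p => 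
      1 / volume.real (stp w (reach w η n p.2) p.1) - 1 / (2*w) with hF
    have hFc : ∀ p, F p = 1 / volume.real (reach w η (n+1) (Fin.cons p.1 p.2)) - 1 / (2*w) := by
      intro p; simp [hF, reach]
    have hFm : Measurable F := by
      have : F = fun p => 1 / volume.real (reach w η (n+1) ((MeasurableEquiv.piFinSuccAbove (fun _ => ℝ) 0).symm p)) - 1 / (2*w) := by
        funext p; rw [hFc]; rfl
      rw [this]
      exact (((reach_vol_meas (n+1)).comp (MeasurableEquiv.measurable _)).const_div 1).sub_const _
    have hFi : Integrable F ((μ 0).prod (Measure.pi (fun j : Fin n => μ j.succ))) := by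
      refine Integrable.of_bound hFm.aestronglyMeasurable (1 / (2 * η)) (Filter.Eventually.of_forall fun p => ?_)
      rw [Real.norm_eq_abs, hFc]; exact hb _ _
    have e1 : ∫ d, (1 / volume.real (reach w η (n+1) d) - 1 / (2*w)) ∂(Measure.pi μ) =
        ∫ p, F p ∂((μ 0).prod (Measure.pi (fun j : Fin n => μ j.succ))) := by
      have := mp.integral_comp' (g := F)
      exact this
    rw [e1, integral_prod_symm _ hFi]
    calc ∫ y, ∫ x, F (x, y) ∂(μ 0) ∂(Measure.pi (fun j : Fin n => μ j.succ))
        ≤ ∫ y, (1 - c0 * w) * (1 / volume.real (reach w η n y) - 1 / (2*w)) ∂(Measure.pi (fun j : Fin n => μ j.succ)) := by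
          apply integral_mono
          · exact hFi.integral_prod_right
          · refine Integrable.const_mul ?_ _
            refine Integrable.of_bound (((reach_vol_meas n).const_div 1).sub_const _).aestronglyMeasurable (1 / (2 * η)) (Filter.Eventually.of_forall fun p => ?_)
            rw [Real.norm_eq_abs]; exact hb _ _
          · intro y
            refine stp_integral hw hc (μ 0) (hμ 0) _ (reach_meas' n y) (reach_sub hηw n y) ?_
            have := measureReal_mono (μ := volume) (sub_reach (w := w) (η := η) n y) 
              (ne_top_of_le_ne_top (by simp) (measure_mono (reach_sub hηw n y)))
            rw [Real.volume_real_Icc, max_eq_left (by linarith)] at this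
            linarith
      _ ≤ _ := by
          rw [integral_const_mul, pow_succ']
          rw [mul_assoc]
          exact mul_le_mul_of_nonneg_left ih (by linarith)

/-- with high probability everything in the window is approximated -/
lemma lueker {w c0 η : ℝ} (hw : 0 < w) (hc : 0 < c0) (hcw : c0 * w ≤ 1) 
    (hη : 0 < η) (hηw : η ≤ w) (n : ℕ) (μ : Fin n → Measure ℝ) [∀ i, IsProbabilityMeasure (μ i)]
    (hμ : ∀ i, ∀ E : Set ℝ, MeasurableSet E → E ⊆ Set.Icc (-(2*w)) (2*w) →
      ENNReal.ofReal c0 * volume E ≤ μ i E) :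
    Measure.pi μ {d | ¬ ∀ z ∈ Set.Icc (-w) w, ∃ S : Finset (Fin n), |z - ∑ j ∈ S, d j| ≤ 2 * η} ≤
      ENNReal.ofReal (2 * w ^ 2 / η ^ 2 * (1 - c0 * w) ^ n) := by
  have hlow : ∀ d : Fin n → ℝ, 2 * η ≤ volume.real (reach w η n d) := by
    intro d
    have := measureReal_mono (μ := volume) (sub_reach (w := w) (η := η) n d) 
      (ne_top_of_le_ne_top (by simp) (measure_mono (reach_sub hηw n d)))
    rw [Real.volume_real_Icc, max_eq_left (by linarith)] at this
    linarith
  have hup : ∀ d : Fin n → ℝ, volume.real (reach w η n d) ≤ 2 * w := by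
    intro d
    have := measureReal_mono (μ := volume) (reach_sub hηw n d) (by simp)
    rw [Real.volume_real_Icc, max_eq_left (by linarith)] at this
    linarith
  set f : (Fin n → ℝ) → ℝ := fun d => 1 / volume.real (reach w η n d) - 1 / (2*w) with hf
  have hf0 : ∀ d, 0 ≤ f d := by
    intro d
    have := one_div_le_one_div_of_le (by linarith [hlow d]) (hup d)
    simp only [hf]; linarith
  have hfi : Integrable f (Measure.pi μ) := by
    refine Integrable.of_bound (((reach_vol_meas n).const_div 1).sub_const _).aestronglyMeasurable (1 / (2 * η)) (Filter.Eventually.of_forall fun d => ?_)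
    rw [Real.norm_eq_abs, abs_of_nonneg (hf0 d)]
    have := one_div_le_one_div_of_le (by linarith) (hlow d)
    have h5 : 0 < 1 / (2 * w) := by positivity
    simp only [hf]; linarith
  have hsub : {d : Fin n → ℝ | ¬ ∀ z ∈ Set.Icc (-w) w, ∃ S : Finset (Fin n), |z - ∑ j ∈ S, d j| ≤ 2 * η}
      ⊆ {d | η / (4 * w^2) ≤ f d} := by
    intro d hd
    by_contra hcon
    apply hd
    intro z hz
    simp only [Set.mem_ofPred_eq, not_le] at hcon
    set v := volume.real (reach w η n d) with hv
    have hvl := hlow d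
    have hvu := hup d
    have hsmall : 2 * w - v < η := by
      have e : 2 * w - v = 2 * w * v * f d := by
        have : v ≠ 0 := by linarith
        simp only [hf, ← hv]; field_simp
      rw [e]
      calc 2 * w * v * f d ≤ 2 * w * (2 * w) * f d := by
            apply mul_le_mul_of_nonneg_right _ (hf0 d)
            exact mul_le_mul_of_nonneg_left hvu (by linarith)
        _ < 2 * w * (2 * w) * (η / (4 * w^2)) := by
            apply mul_lt_mul_of_pos_left hcon (by positivity)
        _ = η := by field_simp; ring
    -- find a reachable point
    have : ∃ z' ∈ reach w η n d, |z - z'| ≤ η := by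
      by_contra hno
      push Not at hno
      obtain ⟨hz1, hz2⟩ := hz
      obtain ⟨lo, hlo, h1, h2, h3⟩ : ∃ lo, lo ≤ z ∧ -w ≤ lo ∧ lo + η ≤ w ∧ z ≤ lo + η := by
        by_cases h : z ≤ 0
        · exact ⟨z, le_refl _, hz1, by linarith, by linarith⟩
        · exact ⟨z - η, by linarith, by linarith, by linarith, by linarith⟩
      have hdis : reach w η n d ⊆ Set.Icc (-w) w \ Set.Icc lo (lo + η) := by
        intro y hy
        refine ⟨reach_sub hηw n d hy, fun hy' => ?_⟩
        have := hno y hy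
        have : |z - y| ≤ η := by
          rw [abs_le]; constructor <;> linarith [hy'.1, hy'.2]
        linarith
      have := measureReal_mono (μ := volume) hdis (ne_top_of_le_ne_top (by simp) (measure_mono Set.sdiff_subset))
      rw [measureReal_sdiff (Set.Icc_subset_Icc h1 h2) measurableSet_Icc (by simp), Real.volume_real_Icc, Real.volume_real_Icc,
        max_eq_left (by linarith), max_eq_left (by linarith)] at this
      linarith
    obtain ⟨z', hz', hzz⟩ := this
    obtain ⟨S, hS⟩ := reach_sound n d z' hz'
    refine ⟨S, ?_⟩
    calc |z - ∑ j ∈ S, d j| = |(z - z') + (z' - ∑ j ∈ S, d j)| := by ring_nf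
      _ ≤ |z - z'| + |z' - ∑ j ∈ S, d j| := abs_add_le _ _
      _ ≤ 2 * η := by linarith
  refine (measure_mono hsub).trans ?_
  have hM := mul_meas_ge_le_integral_of_nonneg (Filter.Eventually.of_forall hf0) hfi (η / (4 * w^2))
  have hL := lueker_int hw hc hcw hη hηw n μ hμ
  rw [← ofReal_measureReal]
  apply ENNReal.ofReal_le_ofReal
  have hρ : 0 ≤ (1 - c0 * w)^n := pow_nonneg (by linarith) n
  have h6 : η / (4 * w^2) * (Measure.pi μ).real {d | η / (4 * w^2) ≤ f d} ≤ (1 - c0 * w)^n * (1 / (2 * η)) := by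
    refine hM.trans (hL.trans ?_)
    apply mul_le_mul_of_nonneg_left _ hρ
    have h5 : 0 < 1 / (2 * w) := by positivity
    linarith
  have h7 : (Measure.pi μ).real {d | η / (4 * w^2) ≤ f d} = (4 * w^2 / η) * (η / (4 * w^2) * (Measure.pi μ).real {d | η / (4 * w^2) ≤ f d}) := by
    field_simp
  rw [h7]
  calc _ ≤ (4 * w^2 / η) * ((1 - c0 * w)^n * (1 / (2 * η))) := mul_le_mul_of_nonneg_left h6 (by positivity)
    _ = _ := by field_simp; ring

-- BEGIN P2
lemma hoeff {Ω : Type} [MeasurableSpace Ω] (P : Measure Ω) [IsProbabilityMeasure P]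
    {ι : Type} [Fintype ι] (U : ι → Ω → ℝ) (hU : ∀ i, Measurable (U i)) (hind : iIndepFun U P)
    (B a : ℝ) (hB : 0 < B) (hb : ∀ i, ∀ᵐ ω ∂P, |U i ω| ≤ B) (ha : 0 ≤ a)
    (hE : 2 * a ≤ ∑ i, ∫ ω, U i ω ∂P) :
    P {ω | ∑ i, U i ω < a} ≤
      ENNReal.ofReal (Real.exp (-a ^ 2 / (2 * (Fintype.card ι * B ^ 2)))) := by
  set V : ι → Ω → ℝ := fun i ω => -U i ω - ∫ ω', -U i ω' ∂P with hV
  have hVs : ∀ i ∈ (Finset.univ : Finset ι), HasSubgaussianMGF (V i) ((‖B - (-B)‖₊ / 2) ^ 2) P := by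
    intro i _
    apply hasSubgaussianMGF_of_mem_Icc (hU i).neg.aemeasurable
    filter_upwards [hb i] with ω h
    rw [abs_le] at h
    constructor <;> simp only [Pi.neg_apply] <;> linarith [h.1, h.2]
  have hVi : iIndepFun V P :=
    hind.comp (fun i x => -x - ∫ ω', -U i ω' ∂P) (fun i => by fun_prop)
  have := HasSubgaussianMGF.measure_sum_ge_le_of_iIndepFun hVi hVs ha
  have hsub : {ω | ∑ i, U i ω < a} ⊆ {ω | a ≤ ∑ i, V i ω} := by
    intro ω hω
    simp only [Set.mem_ofPred_eq] at hω ⊢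
    simp only [hV, Finset.sum_sub_distrib, integral_neg, Finset.sum_neg_distrib]
    linarith
  refine (measure_mono hsub).trans ?_
  rw [← ofReal_measureReal]
  apply ENNReal.ofReal_le_ofReal
  refine this.trans (le_of_eq ?_)
  have e : ((‖B - -B‖₊ : ℝ)) = 2 * B := by
    rw [coe_nnnorm, Real.norm_eq_abs, abs_of_nonneg] <;> linarith
  simp only [Finset.sum_const, Finset.card_univ, nsmul_eq_mul]
  push_cast
  rw [coe_nnnorm] at e
  rw [e]
  congr 4
  ring

lemma greedy {ι : Type} (z : ι → ℝ) (w : ℝ) (hz1 : ∀ i, z i ≤ w) (hw : 0 ≤ w) (s : Finset ι) :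
    ∀ τ : ℝ, 0 ≤ τ → τ ≤ ∑ i ∈ s, z i → ∃ S : Finset ι, τ - w ≤ ∑ i ∈ S, z i ∧ ∑ i ∈ S, z i ≤ τ := by
  induction s using Finset.induction_on with
  | empty => 
    intro τ h0 h1
    exact ⟨∅, by simp at h1 ⊢; constructor <;> linarith⟩
  | insert a s ha ih =>
    intro τ h0 h1
    rw [Finset.sum_insert ha] at h1
    by_cases h : τ ≤ ∑ i ∈ s, z i
    · exact ih τ h0 h
    · exact ⟨s, by linarith [hz1 a], by linarith⟩

noncomputable def zp (w x : ℝ) : ℝ := if 0 < x ∧ x ≤ w then x else 0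

lemma zp_meas (w : ℝ) : Measurable (zp w) := by
  unfold zp
  exact Measurable.ite (measurableSet_Ioc (a := (0:ℝ)) (b := w)) measurable_id measurable_const

lemma zp_nonneg (w x : ℝ) : 0 ≤ zp w x := by
  unfold zp; split_ifs with h
  · exact h.1.le
  · exact le_refl _

lemma zp_le {w : ℝ} (hw : 0 ≤ w) (x : ℝ) : zp w x ≤ w := by
  unfold zp; split_ifs with h
  · exact h.2
  · exact hw

lemma zp_sum {ι : Type} (w : ℝ) (d : ι → ℝ) (S : Finset ι) :
    ∑ i ∈ S, zp w (d i) = ∑ i ∈ S.filter (fun i => 0 < d i ∧ d i ≤ w), d i := by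
  rw [Finset.sum_filter]; rfl

lemma zp_int {w c0 : ℝ} (hw : 0 < w) (hc : 0 < c0) (μ : Measure ℝ) [IsProbabilityMeasure μ]
    (hμ : ∀ E : Set ℝ, MeasurableSet E → E ⊆ Set.Icc (-(2*w)) (2*w) →
      ENNReal.ofReal c0 * volume E ≤ μ E) : c0 * w ^ 2 / 4 ≤ ∫ x, zp w x ∂μ := by
  have h1 : c0 * (w / 2) ≤ μ.real (Set.Ioc (w/2) w) := by
    have := hμ (Set.Ioc (w/2) w) measurableSet_Ioc (fun x hx => ⟨by linarith [hx.1], by linarith [hx.2]⟩)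
    have := ENNReal.toReal_mono (measure_ne_top _ _) this
    rw [ENNReal.toReal_mul, ENNReal.toReal_ofReal hc.le, Real.volume_Ioc, ENNReal.toReal_ofReal (by linarith)] at this
    rw [measureReal_def]; linarith
  have h2 : ∫ x, (Set.Ioc (w/2) w).indicator (fun _ => w / 2) x ∂μ ≤ ∫ x, zp w x ∂μ := by
    apply integral_mono
    · exact (integrable_const _).indicator measurableSet_Ioc
    · refine Integrable.of_bound (zp_meas w).aestronglyMeasurable w (Filter.Eventually.of_forall fun x => ?_)
      rw [Real.norm_eq_abs, abs_of_nonneg (zp_nonneg w x)]; exact zp_le hw.le x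
    · intro x
      by_cases hx : x ∈ Set.Ioc (w/2) w
      · simp only [Set.indicator_of_mem hx]
        rw [zp, if_pos ⟨by linarith [hx.1], hx.2⟩]; exact hx.1.le
      · simp only [Set.indicator_of_notMem hx]; exact zp_nonneg w x
  rw [integral_indicator measurableSet_Ioc] at h2
  simp only [integral_const, measureReal_restrict_apply_univ, smul_eq_mul] at h2
  nlinarith

lemma tree_prob {Ω : Type} [MeasurableSpace Ω] (P : Measure Ω) [IsProbabilityMeasure P]
    {w c0 η M : ℝ} (hw : 0 < w) (hc : 0 < c0) (hcw : c0 * w ≤ 1)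
    (hη : 0 < η) (hηw : η ≤ w) (hM : 0 ≤ M) (T : ℕ) (hT : 8 ≤ T * (c0 * w ^ 2))
    (D Y : Fin 2 × Fin T → Ω → ℝ) (hD : ∀ q, Measurable (D q)) (hY : ∀ q, Measurable (Y q))
    (hind : iIndepFun (fun q ω => (D q ω, Y q ω)) P)
    (hYb : ∀ q, ∀ᵐ ω ∂P, |Y q ω| ≤ M) (hYE : ∀ q, ∫ ω, Y q ω ∂P = 0)
    (hμ : ∀ q, ∀ E : Set ℝ, MeasurableSet E → E ⊆ Set.Icc (-(2*w)) (2*w) →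
      ENNReal.ofReal c0 * volume E ≤ (P.map (D q)) E) 
    (hμ' : ∀ q, ∀ E : Set ℝ, MeasurableSet E → E ⊆ Set.Icc (-(2*w)) (2*w) →
      ENNReal.ofReal c0 * volume E ≤ (P.map (fun ω => -D q ω)) E) :
    P {ω | ¬ ∀ t ∈ Set.Icc (0:ℝ) 1, ∃ S : Finset (Fin 2 × Fin T), 
        |∑ q, Y q ω + ∑ q ∈ S, D q ω - t| ≤ 2 * η} ≤
      ENNReal.ofReal (2 * w ^ 2 / η ^ 2 * (1 - c0 * w) ^ T) + 
      (ENNReal.ofReal (Real.exp (-(c0 * w^2 / 8 / (2 * (M + w))) ^ 2 * T)) +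
      ENNReal.ofReal (Real.exp (-(c0 * w^2 / 8 / (2 * (M + w))) ^ 2 * T))) := by
  have hTpos : (0:ℝ) < T := by
    rcases Nat.eq_zero_or_pos T with h | h
    · subst h; norm_num at hT
    · exact_mod_cast h
  -- general Hoeffding
  have hoe : ∀ (s : ℝ) (_ : |s| = 1) (_ : ∀ q, ∀ E : Set ℝ, MeasurableSet E → E ⊆ Set.Icc (-(2*w)) (2*w) →
      ENNReal.ofReal c0 * volume E ≤ (P.map (fun ω => s * D q ω)) E),
      P {ω | s * ∑ q, Y q ω + ∑ j, zp w (s * D (0, j) ω) < 1} ≤ 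
        ENNReal.ofReal (Real.exp (-(c0 * w^2 / 8 / (2 * (M + w))) ^ 2 * T)) := by
    intro s hs hm
    set g : Fin 2 × Fin T → ℝ × ℝ → ℝ := fun q p => s * p.2 + if q.1 = 0 then zp w (s * p.1) else 0 with hg
    have hgm : ∀ q, Measurable (g q) := by
      intro q
      simp only [hg]
      have := zp_meas w
      split_ifs
      · exact (measurable_snd.const_mul s).add (this.comp (measurable_fst.const_mul s))
      · exact (measurable_snd.const_mul s).add measurable_const
    have hsum : ∀ ω, ∑ q, g q (D q ω, Y q ω) = s * ∑ q, Y q ω + ∑ j, zp w (s * D (0, j) ω) := by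
      intro ω
      simp only [hg, Finset.sum_add_distrib, Finset.mul_sum]
      congr 1
      rw [Fintype.sum_prod_type, Fin.sum_univ_two]
      simp
    have hint : ∀ q, Integrable (Y q) P := fun q =>
      Integrable.of_bound (hY q).aestronglyMeasurable M (hYb q)
    have hzi : ∀ q, Integrable (fun ω => zp w (s * D q ω)) P := by
      intro q
      refine Integrable.of_bound ((zp_meas w).comp ((hD q).const_mul s)).aestronglyMeasurable w (Filter.Eventually.of_forall fun x => ?_)
      rw [Real.norm_eq_abs, abs_of_nonneg (zp_nonneg w _)]; exact zp_le hw.le _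
    have hzE : ∀ q, c0 * w ^ 2 / 4 ≤ ∫ ω, zp w (s * D q ω) ∂P := by
      intro q
      have hmm : Measurable (fun ω => s * D q ω) := (hD q).const_mul s
      have : IsProbabilityMeasure (P.map (fun ω => s * D q ω)) := Measure.isProbabilityMeasure_map hmm.aemeasurable
      have h := zp_int hw hc _ (hm q)
      rwa [integral_map hmm.aemeasurable (zp_meas w).aestronglyMeasurable] at h
    have hE : 2 * (T * (c0 * w^2 / 8)) ≤ ∑ q, ∫ ω, g q (D q ω, Y q ω) ∂P := by
      have : ∀ q : Fin 2 × Fin T, (if q.1 = 0 then c0 * w^2 / 4 else 0) ≤ ∫ ω, g q (D q ω, Y q ω) ∂P := by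
        intro q
        simp only [hg]
        split_ifs
        · rw [integral_add ((hint q).const_mul s) (hzi q), integral_const_mul, hYE]
          simpa using hzE q
        · simp [integral_const_mul, hYE]
      refine le_trans ?_ (Finset.sum_le_sum (fun q _ => this q))
      rw [Fintype.sum_prod_type, Fin.sum_univ_two]
      simp
      linarith
    have key := hoeff P (fun q ω => g q (D q ω, Y q ω)) (fun q => (hgm q).comp ((hD q).prodMk (hY q)))
      (hind.comp g hgm) (M + w) (T * (c0 * w^2 / 8)) (by linarith) ?_ (by positivity) hE
    · refine le_trans (measure_mono ?_) (key.trans (le_of_eq ?_))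
      · intro ω hω
        simp only [Set.mem_ofPred_eq] at hω ⊢
        rw [hsum]; linarith
      · congr 2
        simp only [Fintype.card_prod, Fintype.card_fin]
        have : M + w ≠ 0 := by linarith
        push_cast
        field_simp
    · intro q
      filter_upwards [hYb q] with ω h
      simp only [hg]
      have h1 : |s * Y q ω| ≤ M := by rw [abs_mul, hs, one_mul]; exact h
      have h2 := zp_nonneg w (s * D q ω)
      have h3 := zp_le hw.le (s * D q ω)
      rw [abs_le] at h1 ⊢
      split_ifs <;> constructor <;> linarith [h1.1, h1.2]
  have hP := hoe 1 (by simp) (by simpa using hμ)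
  have hN := hoe (-1) (by simp) (by simpa using hμ')
  -- Lueker
  have hprob : ∀ j, IsProbabilityMeasure (P.map (D ((1 : Fin 2), j))) := fun j => 
    Measure.isProbabilityMeasure_map (hD _).aemeasurable
  have hL := lueker hw hc hcw hη hηw T (fun j => P.map (D (1, j))) (fun j => hμ (1, j))
  have hDind : iIndepFun (fun j ω => D ((1 : Fin 2), j) ω) P := by
    have h1 := hind.comp (fun _ p => p.1) (fun _ => measurable_fst)
    exact h1.precomp (g := fun j : Fin T => ((1 : Fin 2), j)) (fun a b h => by simpa using h)
  have hmap := iIndepFun.map_fun_eq_pi_map (fun j => (hD (1, j)).aemeasurable) hDind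
  rw [← hmap] at hL
  have hL2 := (Measure.le_map_apply (measurable_pi_lambda _ (fun j => hD ((1 : Fin 2), j))).aemeasurable _).trans hL
  refine le_trans ?_ (add_le_add hL2 (add_le_add hP hN))
  refine le_trans (measure_mono ?_) ((measure_union_le _ _).trans (add_le_add le_rfl (measure_union_le _ _)))
  intro ω hω
  by_contra hcon
  simp only [Set.mem_union, Set.mem_preimage, Set.mem_ofPred_eq, not_or, not_not, not_lt] at hcon
  obtain ⟨hcov, h1, h2⟩ := hcon
  apply hω
  intro t ht
  have hA : ∃ SA : Finset (Fin T), (t - ∑ q, Y q ω) - ∑ j ∈ SA, D (0, j) ω ∈ Set.Icc (-w) w := by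
    by_cases h0 : 0 ≤ t - ∑ q, Y q ω
    · obtain ⟨S, hS1, hS2⟩ := greedy (fun j : Fin T => zp w (1 * D (0, j) ω)) w (fun j => zp_le hw.le _) hw.le 
        Finset.univ _ h0 (by linarith [ht.2])
      rw [zp_sum] at hS1 hS2
      refine ⟨S.filter (fun i => 0 < 1 * D (0, i) ω ∧ 1 * D (0, i) ω ≤ w), ?_, ?_⟩
      · simp only [one_mul] at hS1 hS2 ⊢; linarith
      · simp only [one_mul] at hS1 hS2 ⊢; linarith
    · obtain ⟨S, hS1, hS2⟩ := greedy (fun j : Fin T => zp w (-1 * D (0, j) ω)) w (fun j => zp_le hw.le _) hw.le 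
        Finset.univ (-(t - ∑ q, Y q ω)) (by linarith) (by linarith [ht.1])
      rw [zp_sum] at hS1 hS2
      refine ⟨S.filter (fun i => 0 < -1 * D (0, i) ω ∧ -1 * D (0, i) ω ≤ w), ?_, ?_⟩
      · rw [← Finset.mul_sum] at hS1 hS2; linarith
      · rw [← Finset.mul_sum] at hS1 hS2; linarith
  obtain ⟨SA, hSA⟩ := hA
  obtain ⟨SB, hSB⟩ := hcov _ hSA
  refine ⟨({0} ×ˢ SA) ∪ ({1} ×ˢ SB), ?_⟩
  rw [Finset.sum_union]
  · rw [Finset.sum_product, Finset.sum_product]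
    simp only [Finset.sum_singleton]
    rw [abs_sub_comm] at hSB
    convert! hSB using 2
    ring
  · rw [Finset.disjoint_left]
    intro q hq hq'
    simp only [Finset.mem_product, Finset.mem_singleton] at hq hq'
    rw [hq.1] at hq'
    exact absurd hq'.1 (by decide)

-- BEGIN P3
noncomputable def pairD (x : Fin 2 × Fin 2 → ℝ) : ℝ :=
  if 0 < x (0, 0) + x (0, 1) ∧ 0 < x (1, 0) + x (1, 1) then -2 * (x (0, 0) + x (1, 0)) else 0

lemma pairD_meas : Measurable pairD := by
  unfold pairD
  refine Measurable.ite ?_ (by fun_prop) measurable_const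
  have h1 : Measurable (fun x : Fin 2 × Fin 2 → ℝ => x (0, 0) + x (0, 1)) := by fun_prop
  have h2 : Measurable (fun x : Fin 2 × Fin 2 → ℝ => x (1, 0) + x (1, 1)) := by fun_prop
  exact (measurableSet_lt measurable_const h1).inter (measurableSet_lt measurable_const h2)

lemma pair_minor {Ω : Type} [MeasurableSpace Ω] (P : Measure Ω) [IsProbabilityMeasure P]
    (s : Fin 2 × Fin 2 → Ω → ℝ) (hs : ∀ q, Measurable (s q)) (hind : iIndepFun s P)
    (β : ℝ) (hβ : -(1/2) ≤ β)
    (hm : ∀ q, ∀ E : Set ℝ, MeasurableSet E → E ⊆ Set.Icc β (β + 1) →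
      ENNReal.ofReal (1/2) * volume E ≤ P.map (s q) E)
    (hm' : ∀ q, ∀ E : Set ℝ, MeasurableSet E → E ⊆ Set.Icc (-(β + 1)) (-β) →
      ENNReal.ofReal (1/2) * volume E ≤ P.map (s q) E)
    (E : Set ℝ) (hE : MeasurableSet E) (hEs : E ⊆ Set.Icc (-(2*(1/32))) (2*(1/32))) :
    ENNReal.ofReal (1/4096) * volume E ≤ P.map (fun ω => pairD (fun q => s q ω)) E := by
  have hmeas : Measurable (fun ω => pairD (fun q => s q ω)) :=
    pairD_meas.comp (measurable_pi_lambda _ hs)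
  rw [Measure.map_apply hmeas hE]
  set J : Set ℝ := Set.Icc (β + 3/4) (β + 1) with hJ
  set I' : Set ℝ := Set.Icc (-(β + 11/16)) (-(β + 9/16)) with hI'
  set Q : Set (ℝ × ℝ) := {p | p.1 ∈ Set.Ioo (β + 1/2) (β + 3/4) ∧ p.2 ∈ I' ∧ -2 * (p.1 + p.2) ∈ E} with hQ
  have hQm : MeasurableSet Q := by
    refine MeasurableSet.inter (measurable_fst measurableSet_Ioo) (MeasurableSet.inter (measurable_snd measurableSet_Icc) ?_)
    exact ((measurable_fst.add measurable_snd).const_mul (-2)) hE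
  have hind1 : IndepFun (fun ω => (s (0,0) ω, s (1,0) ω)) (fun ω => (s (0,1) ω, s (1,1) ω)) P :=
    hind.indepFun_prodMk_prodMk hs (0,0) (1,0) (0,1) (1,1) (by decide) (by decide) (by decide) (by decide)
  have hind2 : IndepFun (s (0,0)) (s (1,0)) P := hind.indepFun (by decide)
  have hind3 : IndepFun (s (0,1)) (s (1,1)) P := hind.indepFun (by decide)
  have hsub : ((fun ω => (s (0,0) ω, s (1,0) ω)) ⁻¹' Q) ∩ ((fun ω => (s (0,1) ω, s (1,1) ω)) ⁻¹' (J ×ˢ J))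
      ⊆ (fun ω => pairD (fun q => s q ω)) ⁻¹' E := by
    rintro ω ⟨⟨h1, h2, h3⟩, h4, h5⟩
    simp only [hJ, hI', Set.mem_Icc, Set.mem_Ioo] at h1 h2 h4 h5
    simp only [Set.mem_preimage, pairD]
    rw [if_pos]
    · exact h3
    · constructor <;> linarith [h1.1, h2.1, h4.1, h5.1]
  refine le_trans ?_ (measure_mono hsub)
  rw [hind1.measure_inter_preimage_eq_mul _ _ hQm (measurableSet_Icc.prod measurableSet_Icc)]
  have hJJ : ENNReal.ofReal (1/64) ≤ P ((fun ω => (s (0,1) ω, s (1,1) ω)) ⁻¹' (J ×ˢ J)) := by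
    rw [Set.mk_preimage_prod, hind3.measure_inter_preimage_eq_mul _ _ measurableSet_Icc measurableSet_Icc,
      ← Measure.map_apply (hs _) measurableSet_Icc, ← Measure.map_apply (hs _) measurableSet_Icc]
    have : ∀ q, ENNReal.ofReal (1/8) ≤ P.map (s q) J := by
      intro q
      refine le_trans (le_of_eq ?_) (hm q J measurableSet_Icc (Set.Icc_subset_Icc (by linarith) le_rfl))
      rw [hJ, Real.volume_Icc, ← ENNReal.ofReal_mul (by norm_num)]
      congr 1; ring
    refine le_trans (le_of_eq ?_) (mul_le_mul' (this _) (this _))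
    rw [← ENNReal.ofReal_mul (by norm_num)]; norm_num
  have hQQ : ENNReal.ofReal (1/64) * volume E ≤ P ((fun ω => (s (0,0) ω, s (1,0) ω)) ⁻¹' Q) := by
    have hpr0 : IsProbabilityMeasure (P.map (s (0,0))) := Measure.isProbabilityMeasure_map (hs _).aemeasurable
    have hpr1 : IsProbabilityMeasure (P.map (s (1,0))) := Measure.isProbabilityMeasure_map (hs _).aemeasurable
    rw [← Measure.map_apply ((hs _).prodMk (hs _)) hQm,
      (indepFun_iff_map_prod_eq_prod_map_map (hs _).aemeasurable (hs _).aemeasurable).1 hind2,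
      Measure.prod_apply_symm hQm]
    have hI : ENNReal.ofReal (1/16) ≤ P.map (s (1,0)) I' := by
      refine le_trans (le_of_eq ?_) (hm' (1,0) I' measurableSet_Icc (Set.Icc_subset_Icc (by linarith) (by linarith)))
      rw [hI', Real.volume_Icc, ← ENNReal.ofReal_mul (by norm_num)]
      congr 1; ring
    calc ENNReal.ofReal (1/64) * volume E 
        = (ENNReal.ofReal (1/4) * volume E) * ENNReal.ofReal (1/16) := by
          rw [mul_right_comm, ← ENNReal.ofReal_mul (by norm_num)]; norm_num
      _ ≤ (ENNReal.ofReal (1/4) * volume E) * P.map (s (1,0)) I' := mul_le_mul' le_rfl hI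
      _ = ∫⁻ y in I', ENNReal.ofReal (1/4) * volume E ∂(P.map (s (1,0))) := by
          simp
      _ ≤ ∫⁻ y in I', P.map (s (0,0)) ((fun x => (x, y)) ⁻¹' Q) ∂(P.map (s (1,0))) := by
          apply setLIntegral_mono' measurableSet_Icc
          intro y hy
          have e1 : (fun x => (x, y)) ⁻¹' Q = (fun x => x + y) ⁻¹' ((fun x => -2 * x) ⁻¹' E) := by
            ext x
            simp only [hQ, Set.mem_preimage, Set.mem_ofPred_eq]
            constructor
            · exact fun h => h.2.2
            · intro h
              refine ⟨?_, hy, h⟩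
              have := hEs h
              simp only [hI', Set.mem_Icc] at this hy
              constructor <;> linarith [this.1, this.2, hy.1, hy.2]
          have e2 : volume ((fun x => (x, y)) ⁻¹' Q) = ENNReal.ofReal (1/2) * volume E := by
            rw [e1, measure_preimage_add_right, Real.volume_preimage_mul_left (by norm_num)]
            norm_num
          refine le_trans (le_of_eq ?_) (hm (0,0) _ (measurable_prodMk_right hQm) ?_)
          · rw [e2, ← mul_assoc, ← ENNReal.ofReal_mul (by norm_num)]; norm_num
          · intro x hx
            exact ⟨by linarith [hx.1.1], by linarith [hx.1.2]⟩
      _ ≤ _ := setLIntegral_le_lintegral _ _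
  calc ENNReal.ofReal (1/4096) * volume E = (ENNReal.ofReal (1/64) * volume E) * ENNReal.ofReal (1/64) := by
        rw [mul_right_comm, ← ENNReal.ofReal_mul (by norm_num)]; norm_num
    _ ≤ _ := mul_le_mul' hQQ hJJ

lemma minor_neg {Ω : Type} [MeasurableSpace Ω] (P : Measure Ω) (D : Ω → ℝ) (hD : Measurable D)
    {w c0 : ℝ} (hm : ∀ E : Set ℝ, MeasurableSet E → E ⊆ Set.Icc (-(2*w)) (2*w) →
      ENNReal.ofReal c0 * volume E ≤ (P.map D) E) :
    ∀ E : Set ℝ, MeasurableSet E → E ⊆ Set.Icc (-(2*w)) (2*w) →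
      ENNReal.ofReal c0 * volume E ≤ (P.map (fun ω => -D ω)) E := by
  intro E hE hs
  have := hm (-E) hE.neg (fun x hx => by
    have := hs (Set.mem_neg.1 hx)
    constructor <;> linarith [this.1, this.2])
  rw [Measure.measure_neg] at this
  have hDn : Measurable (fun ω => -D ω) := hD.neg
  rw [Measure.map_apply hDn hE]
  rw [Measure.map_apply hD hE.neg] at this
  exact this

lemma indep_curry {Ω : Type} [MeasurableSpace Ω] (P : Measure Ω) [IsProbabilityMeasure P]
    {ι κ : Type} [Fintype ι] [Fintype κ] (s : ι × κ → Ω → ℝ) (hs : ∀ q, Measurable (s q))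
    (hind : iIndepFun s P) : iIndepFun (fun i ω => (fun j => s (i, j) ω : κ → ℝ)) P := by
  have h1 : iIndepFun (fun (p : (_ : ι) × κ) ω => s (p.1, p.2) ω) P :=
    hind.precomp (g := fun p : (_ : ι) × κ => (p.1, p.2)) (Equiv.sigmaEquivProd ι κ).injective
  have hpr : ∀ i j, IsProbabilityMeasure (P.map (s (i, j))) := fun i j =>
    Measure.isProbabilityMeasure_map (hs _).aemeasurable
  have h2 := (iIndepFun_iff_map_fun_eq_infinitePi_map (fun p : (_ : ι) × κ => hs (p.1, p.2))).1 h1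
  rw [iIndepFun_iff_map_fun_eq_infinitePi_map (fun i => measurable_pi_lambda _ (fun j => hs _))]
  have h3 := Measure.infinitePi_map_piCurry (fun (i : ι) (j : κ) => P.map (s (i, j)))
  rw [← h2, Measure.map_map (by fun_prop) (measurable_pi_lambda _ (fun p => hs _))] at h3
  have e : (MeasurableEquiv.piCurry fun (_ : ι) (_ : κ) => ℝ) ∘ (fun ω (p : (_ : ι) × κ) => s (p.1, p.2) ω) =
    fun ω i j => s (i, j) ω := by
    ext; simp [Sigma.curry]
  rw [e] at h3
  rw [h3]
  congr 1
  funext i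
  have h4 : iIndepFun (fun j => s (i, j)) P := hind.precomp (g := fun j => (i, j)) (fun a b h => by simpa using h)
  exact ((iIndepFun_iff_map_fun_eq_infinitePi_map (fun j => hs (i, j))).1 h4).symm

-- BEGIN P4
abbrev NI (k m : ℕ) := Fin k × Fin 2 × (Fin (2 * m) ⊕ (Fin (2 * m) × Fin 2))

def vtx {k m : ℕ} (x : NI k m) : HV k m := (x.1, x.2.1, Sum.inr x.2.2)

def par {k m : ℕ} : NI k m → HV k m
  | (i, s, Sum.inl _) => (i, s, Sum.inl ())
  | (i, s, Sum.inr (j, _)) => (i, s, Sum.inr (Sum.inl j))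

def edg {k m : ℕ} (x : NI k m) : Sym2 (HV k m) := s(par x, vtx x)

lemma edg_inj {k m : ℕ} : Function.Injective (edg : NI k m → Sym2 (HV k m)) := by
  rintro ⟨i, s, j | ⟨j, t⟩⟩ ⟨i', s', j' | ⟨j', t'⟩⟩ h <;>
  · simp only [edg, par, vtx, Sym2.eq_iff, Prod.mk.injEq, Sum.inr.injEq, Sum.inl.injEq, reduceCtorEq] at h ⊢
    grind

lemma mem_edgeSet {k m : ℕ} (e : Sym2 (HV k m)) : e ∈ (HGraph k m).edgeSet ↔ ∃ x, edg x = e := by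
  induction e using Sym2.ind with
  | _ u v =>
  rw [SimpleGraph.mem_edgeSet, HGraph, SimpleGraph.fromRel_adj]
  constructor
  · obtain ⟨i, s, u⟩ := u
    obtain ⟨i', s', v⟩ := v
    rintro ⟨_, ⟨h1, h2, h3⟩ | ⟨h1, h2, h3⟩⟩ <;> simp only at h1 h2 h3 <;> subst h1 h2 <;>
      rcases h3 with ⟨j, rfl, rfl⟩ | ⟨j, t, rfl, rfl⟩
    · exact ⟨(i, s, Sum.inl j), rfl⟩
    · exact ⟨(i, s, Sum.inr (j, t)), rfl⟩
    · exact ⟨(i', s', Sum.inl j), Sym2.eq_swap⟩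
    · exact ⟨(i', s', Sum.inr (j, t)), Sym2.eq_swap⟩
  · rintro ⟨⟨i, s, j | ⟨j, t⟩⟩, h⟩ <;> simp only [edg, par, vtx, Sym2.eq_iff] at h <;>
      rcases h with ⟨rfl, rfl⟩ | ⟨rfl, rfl⟩ <;> simp [treeRel]

lemma edg_mem {k m : ℕ} (x : NI k m) : edg x ∈ (HGraph k m).edgeSet := (mem_edgeSet _).2 ⟨x, rfl⟩

noncomputable def sv {k m : ℕ} (X : Sym2 (HV k m) → ℝ) (σ : HV k m → ℝ) (x : NI k m) : ℝ :=
  σ (par x) * σ (vtx x) * X (edg x)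

lemma cutValue_eq {k m : ℕ} (X : Sym2 (HV k m) → ℝ) (σ : HV k m → ℝ) :
    cutValue (HGraph k m) X σ = (1/2) * ∑ x, (X (edg x) - sv X σ x) := by
  unfold cutValue
  congr 1
  have : (Finset.univ.filter (fun e => e ∈ (HGraph k m).edgeSet)) = Finset.univ.image edg := by
    ext e; simp [mem_edgeSet]
  rw [this, Finset.sum_image (fun a _ b _ h => edg_inj h)]
  refine Finset.sum_congr rfl (fun x _ => ?_)
  simp only [edg, sv, Sym2.lift_mk]
  ring

lemma impr_eq {k m : ℕ} (X : Sym2 (HV k m) → ℝ) (σ : HV k m → ℝ) (S : Finset (HV k m)) :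
    impr (HGraph k m) X σ S = (1/2) * ∑ x, (sv X σ x - sv X (flip σ S) x) := by
  rw [impr, cutValue_eq, cutValue_eq, ← mul_sub, ← Finset.sum_sub_distrib]
  congr 1
  exact Finset.sum_congr rfl (fun x _ => by ring)

abbrev MI (k m : ℕ) := Fin k × Fin 2 × Fin (2 * m)

def mid {k m : ℕ} (a : MI k m) : NI k m := (a.1, a.2.1, Sum.inl a.2.2)
def pen {k m : ℕ} (a : MI k m) : NI k m := (a.1, a.2.1, Sum.inr (a.2.2, 0))

noncomputable def mv {k m : ℕ} (a : MI k m) : Finset (HV k m) :=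
  {(a.1, a.2.1, Sum.inr (Sum.inl a.2.2)), (a.1, a.2.1, Sum.inr (Sum.inr (a.2.2, 1)))}

lemma sv_flip_mv {k m : ℕ} (X : Sym2 (HV k m) → ℝ) (σ : HV k m → ℝ) (a : MI k m) (y : NI k m) :
    sv X (flip σ (mv a)) y = if y = mid a ∨ y = pen a then - sv X σ y else sv X σ y := by
  obtain ⟨i, s, j⟩ := a
  rcases y with ⟨i', s', j' | ⟨j', t'⟩⟩
  · by_cases h : i' = i ∧ s' = s ∧ j' = j
    · obtain ⟨rfl, rfl, rfl⟩ := h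
      simp [sv, flip, mv, mid, pen, par, vtx]
    · simp only [sv, flip, mv, mid, pen, par, vtx, Finset.mem_insert, Finset.mem_singleton, Prod.mk.injEq,
        Sum.inr.injEq, Sum.inl.injEq, reduceCtorEq, and_false, or_false, if_false, if_neg h]
  · by_cases h : i' = i ∧ s' = s ∧ j' = j
    · obtain ⟨rfl, rfl, rfl⟩ := h
      fin_cases t' <;> simp [sv, flip, mv, mid, pen, par, vtx]
    · have h2 : ∀ t : Fin 2, ¬ (i' = i ∧ s' = s ∧ j' = j ∧ t' = t) := fun t hh => h ⟨hh.1, hh.2.1, hh.2.2.1⟩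
      simp only [sv, flip, mv, mid, pen, par, vtx, Finset.mem_insert, Finset.mem_singleton, Prod.mk.injEq,
        Sum.inr.injEq, Sum.inl.injEq, reduceCtorEq, and_false, or_false, false_or, if_false, if_neg h, if_neg (h2 _)]

lemma impr_mv {k m : ℕ} (X : Sym2 (HV k m) → ℝ) (σ : HV k m → ℝ) (a : MI k m) :
    impr (HGraph k m) X σ (mv a) = sv X σ (mid a) + sv X σ (pen a) := by
  rw [impr_eq]
  have hne : mid a ≠ pen a := by simp [mid, pen]
  have : ∀ x, sv X σ x - sv X (flip σ (mv a)) x =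
      (if x = mid a then 2 * sv X σ x else 0) + (if x = pen a then 2 * sv X σ x else 0) := by
    intro x
    rw [sv_flip_mv]
    by_cases h1 : x = mid a
    · subst h1; simp [hne]; ring
    · by_cases h2 : x = pen a
      · subst h2; simp [hne.symm]; ring
      · simp [h1, h2]
  simp only [this, Finset.sum_add_distrib, Finset.sum_ite_eq', Finset.mem_univ, if_true]
  ring

lemma impr_center {k m : ℕ} (X : Sym2 (HV k m) → ℝ) (σ : HV k m → ℝ) (i : Fin k) (s : Fin 2) :
    impr (HGraph k m) X σ {center k m i s} = ∑ j, sv X σ (mid (i, s, j)) := by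
  rw [impr_eq]
  have : ∀ x : NI k m, sv X σ x - sv X (flip σ {center k m i s}) x =
      ∑ j, (if mid (i, s, j) = x then 2 * sv X σ x else 0) := by
    rintro ⟨i', s', j | ⟨j, t⟩⟩
    · by_cases h : i = i' ∧ s = s'
      · obtain ⟨rfl, rfl⟩ := h
        simp [sv, flip, center, mid, par, vtx]
        ring
      · have h' : ¬ (i' = i ∧ s' = s) := fun hh => h ⟨hh.1.symm, hh.2.symm⟩
        have h2 : ∀ j', ¬ (i = i' ∧ s = s' ∧ j' = j) := fun t hh => h ⟨hh.1, hh.2.1⟩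
        simp [sv, flip, center, mid, par, vtx, h', h2]
    · simp [sv, flip, center, mid, par, vtx]
  simp only [this]
  rw [Finset.sum_comm, Finset.mul_sum]
  refine Finset.sum_congr rfl (fun j _ => ?_)
  simp

lemma list_ok {k m : ℕ} (X : Sym2 (HV k m) → ℝ) (l : List (MI k m)) : ∀ (σ : HV k m → ℝ), l.Nodup →
    (∀ a ∈ l, 0 < sv X σ (mid a) + sv X σ (pen a)) →
    Improving (HGraph k m) X σ (l.map mv) ∧
    ∀ a, sv X (applyList σ (l.map mv)) (mid a) = if a ∈ l then - sv X σ (mid a) else sv X σ (mid a) := by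
  induction l with
  | nil => intro σ _ _; simp [Improving, applyList]
  | cons c l ih =>
    intro σ hn hp
    rw [List.nodup_cons] at hn
    have hmm : ∀ a b : MI k m, mid a = mid b ↔ a = b := by
      rintro ⟨i, s, j⟩ ⟨i', s', j'⟩; simp [mid]
    have hpp : ∀ a b : MI k m, pen a = pen b ↔ a = b := by
      rintro ⟨i, s, j⟩ ⟨i', s', j'⟩; simp [pen]
    have hmp : ∀ a b : MI k m, mid a ≠ pen b := by
      rintro ⟨i, s, j⟩ ⟨i', s', j'⟩; simp [mid, pen]
    have h1 : ∀ a, sv X (flip σ (mv c)) (mid a) = if a = c then - sv X σ (mid a) else sv X σ (mid a) := by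
      intro a; rw [sv_flip_mv]; simp [hmm, hmp]
    have h2 : ∀ a, sv X (flip σ (mv c)) (pen a) = if a = c then - sv X σ (pen a) else sv X σ (pen a) := by
      intro a; rw [sv_flip_mv]; simp [hpp, (hmp _ _).symm]
    obtain ⟨h3, h4⟩ := ih (flip σ (mv c)) hn.2 (by
      intro a ha
      have : a ≠ c := by rintro rfl; exact hn.1 ha
      rw [h1, h2, if_neg this, if_neg this]
      exact hp a (List.mem_cons_of_mem _ ha))
    refine ⟨⟨?_, h3⟩, ?_⟩
    · rw [impr_mv]; exact hp c (by simp)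
    · intro a
      have := h4 a
      simp only [List.map_cons, applyList]
      rw [this, h1]
      by_cases hac : a = c
      · subst hac; simp [hn.1]
      · simp [hac]

lemma det_final {k m : ℕ} (X : Sym2 (HV k m) → ℝ) (σ : HV k m → ℝ) (A : Finset (MI k m))
    (hA : ∀ a ∈ A, 0 < sv X σ (mid a) + sv X σ (pen a)) :
    ∃ L : List (Finset (HV k m)), (∀ S ∈ L, S.card ≤ 3) ∧ Improving (HGraph k m) X σ L ∧
      (∀ S ∈ L, ∀ x ∈ S, x.2.2 ≠ Sum.inl ()) ∧
      ∀ i s, impr (HGraph k m) X (applyList σ L) {center k m i s} =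
        ∑ j, (if (i, s, j) ∈ A then - sv X σ (mid (i, s, j)) else sv X σ (mid (i, s, j))) := by
  obtain ⟨h1, h2⟩ := list_ok X A.toList σ A.nodup_toList (by simpa using hA)
  refine ⟨A.toList.map mv, ?_, h1, ?_, ?_⟩
  · intro S hS
    obtain ⟨a, _, rfl⟩ := List.mem_map.1 hS
    exact (Finset.card_le_two).trans (by norm_num)
  · intro S hS x hx
    obtain ⟨a, _, rfl⟩ := List.mem_map.1 hS
    simp only [mv, Finset.mem_insert, Finset.mem_singleton] at hx
    rcases hx with rfl | rfl <;> simp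
  · intro i s
    rw [impr_center]
    refine Finset.sum_congr rfl (fun j _ => ?_)
    rw [h2]; simp

-- BEGIN P5
lemma indep_zip {Ω : Type} [MeasurableSpace Ω] (P : Measure Ω) [IsProbabilityMeasure P]
    {ι : Type} [Fintype ι] (X : ι → Ω → ℝ) (Y : ι → Ω → Bool) (hX : ∀ i, Measurable (X i))
    (hY : ∀ i, Measurable (Y i)) (iX : iIndepFun X P) (iY : iIndepFun Y P)
    (h : IndepFun (fun ω i => X i ω) (fun ω i => Y i ω) P) :
    iIndepFun (fun i ω => (X i ω, Y i ω)) P := by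
  have hpX : ∀ i, IsProbabilityMeasure (P.map (X i)) := fun i => Measure.isProbabilityMeasure_map (hX i).aemeasurable
  have hpY : ∀ i, IsProbabilityMeasure (P.map (Y i)) := fun i => Measure.isProbabilityMeasure_map (hY i).aemeasurable
  have hXm : Measurable (fun ω i => X i ω) := measurable_pi_lambda _ hX
  have hYm : Measurable (fun ω i => Y i ω) := measurable_pi_lambda _ hY
  have h1 := (indepFun_iff_map_prod_eq_prod_map_map hXm.aemeasurable hYm.aemeasurable).1 h
  rw [(iIndepFun_iff_map_fun_eq_pi_map (fun i => (hX i).aemeasurable)).1 iX,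
    (iIndepFun_iff_map_fun_eq_pi_map (fun i => (hY i).aemeasurable)).1 iY,
    ← (measurePreserving_arrowProdEquivProdArrow ℝ Bool ι (fun i => P.map (X i)) (fun i => P.map (Y i))).map_eq] at h1
  rw [iIndepFun_iff_map_fun_eq_pi_map (fun i => ((hX i).prodMk (hY i)).aemeasurable)]
  have h2 : ∀ i, P.map (fun ω => (X i ω, Y i ω)) = (P.map (X i)).prod (P.map (Y i)) := by
    intro i
    have : IndepFun (X i) (Y i) P := by
      have a1 : Measurable (fun f : ι → ℝ => f i) := measurable_pi_apply i
      have a2 : Measurable (fun f : ι → Bool => f i) := measurable_pi_apply i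
      exact h.comp a1 a2
    exact (indepFun_iff_map_prod_eq_prod_map_map (hX i).aemeasurable (hY i).aemeasurable).1 this
  simp only [h2]
  have h3 := congrArg (Measure.map (MeasurableEquiv.arrowProdEquivProdArrow ℝ Bool ι).symm) h1
  rw [Measure.map_map (by fun_prop) (hXm.prodMk hYm), Measure.map_map (by fun_prop) (by fun_prop),
    MeasurableEquiv.symm_comp_self, Measure.map_id] at h3
  exact h3

lemma uniform_map_inj {W : Type} [Fintype W] [Nonempty W] [MeasurableSpace W] [MeasurableSingletonClass W]
    (f : W → W) (hf : Function.Injective f) :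
    (PMF.uniformOfFintype W).toMeasure.map f = (PMF.uniformOfFintype W).toMeasure := by
  apply Measure.ext_of_singleton
  intro a
  obtain ⟨z, rfl⟩ := (Finite.injective_iff_surjective.1 hf) a
  rw [Measure.map_apply (measurable_of_countable f) (measurableSet_singleton _)]
  have : f ⁻¹' {f z} = {z} := by ext y; simp [hf.eq_iff]
  rw [this, PMF.toMeasure_apply_singleton _ _ (measurableSet_singleton _),
    PMF.toMeasure_apply_singleton _ _ (measurableSet_singleton _)]
  simp

lemma uniform_pi {ι : Type} [Fintype ι] [Fintype (ι → Bool)] :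
    (PMF.uniformOfFintype (ι → Bool)).toMeasure = Measure.pi (fun _ : ι => (PMF.uniformOfFintype Bool).toMeasure) := by
  apply Measure.ext_of_singleton
  intro a
  rw [PMF.toMeasure_apply_singleton _ _ (measurableSet_singleton _), Measure.pi_singleton]
  simp only [PMF.toMeasure_apply_singleton _ _ (measurableSet_singleton _), PMF.uniformOfFintype_apply]
  have : Fintype.card (ι → Bool) = 2 ^ Fintype.card ι := by
    rw [← Nat.card_eq_fintype_card, Nat.card_fun, Nat.card_eq_fintype_card, Nat.card_eq_fintype_card]; simp
  rw [this]
  simp [ENNReal.inv_pow]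

def tau {k m : ℕ} (σ : HV k m → Bool) : HV k m → Bool
  | (i, s, Sum.inl u) => σ (i, s, Sum.inl u)
  | (i, s, Sum.inr y) => xor (σ (par (i, s, y))) (σ (i, s, Sum.inr y))

lemma tau_inj {k m : ℕ} : Function.Injective (tau : (HV k m → Bool) → HV k m → Bool) := by
  intro σ σ' h
  have h0 : ∀ i s u, σ (i, s, Sum.inl u) = σ' (i, s, Sum.inl u) := fun i s u => congrFun h (i, s, Sum.inl u)
  have h1 : ∀ i s j, σ (i, s, Sum.inr (Sum.inl j)) = σ' (i, s, Sum.inr (Sum.inl j)) := by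
    intro i s j
    have := congrFun h (i, s, Sum.inr (Sum.inl j))
    simpa [tau, par, h0] using this
  have h2 : ∀ i s j, σ (i, s, Sum.inr (Sum.inr j)) = σ' (i, s, Sum.inr (Sum.inr j)) := by
    rintro i s ⟨j, t⟩
    have := congrFun h (i, s, Sum.inr (Sum.inr (j, t)))
    simpa [tau, par, h1] using this
  funext ⟨i, s, v⟩
  rcases v with u | j | j
  · exact h0 _ _ _
  · exact h1 _ _ _
  · exact h2 _ _ _

noncomputable def sg (p : ℝ × Bool) : ℝ := if p.2 then -p.1 else p.1

lemma sg_meas : Measurable sg := by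
  unfold sg
  exact Measurable.ite (measurable_snd (measurableSet_singleton true)) measurable_fst.neg measurable_fst

lemma sg_eq {k m : ℕ} (X : Sym2 (HV k m) → ℝ) (σ : HV k m → Bool) (x : NI k m) :
    sv X (toCut σ) x = sg (X (edg x), tau σ (vtx x)) := by
  obtain ⟨i, s, y⟩ := x
  simp only [sv, sg, toCut, tau, vtx]
  rcases Bool.eq_false_or_eq_true (σ (par (i, s, y))) with hp | hp <;>
    rcases Bool.eq_false_or_eq_true (σ (i, s, Sum.inr y)) with hq | hq <;> simp [hp, hq]

lemma uniformIcc_apply (b : ℝ) (E : Set ℝ) (hE : MeasurableSet E) :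
    uniformIcc b (b + 1) E = volume (E ∩ Set.Icc b (b + 1)) := by
  simp [uniformIcc, Measure.restrict_apply hE]

lemma sg_laws {Ω : Type} [MeasurableSpace Ω] (P : Measure Ω) [IsProbabilityMeasure P] (b : ℝ)
    (X : Ω → ℝ) (Y : Ω → Bool) (hX : Measurable X) (hY : Measurable Y) (hi : IndepFun X Y P)
    (lX : P.map X = uniformIcc b (b + 1)) (lY : P.map Y = (PMF.uniformOfFintype Bool).toMeasure) :
    (∀ᵐ ω ∂P, |sg (X ω, Y ω)| ≤ |b| + 1) ∧ ∫ ω, sg (X ω, Y ω) ∂P = 0 ∧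
    (∀ E : Set ℝ, MeasurableSet E → E ⊆ Set.Icc (max b (-b-1)) (max b (-b-1) + 1) →
      ENNReal.ofReal (1/2) * volume E ≤ P.map (fun ω => sg (X ω, Y ω)) E) ∧
    (∀ E : Set ℝ, MeasurableSet E → E ⊆ Set.Icc (-(max b (-b-1) + 1)) (-max b (-b-1)) →
      ENNReal.ofReal (1/2) * volume E ≤ P.map (fun ω => sg (X ω, Y ω)) E) := by
  have hm : Measurable (fun ω => sg (X ω, Y ω)) := sg_meas.comp (hX.prodMk hY)
  have hYv : ∀ c, P (Y ⁻¹' {c}) = ENNReal.ofReal (1/2) := by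
    intro c
    rw [← Measure.map_apply hY (measurableSet_singleton _), lY, PMF.toMeasure_apply_singleton _ _ (measurableSet_singleton _)]
    simp
  have hpos : ∀ E : Set ℝ, MeasurableSet E → E ⊆ Set.Icc b (b + 1) →
      ENNReal.ofReal (1/2) * volume E ≤ P.map (fun ω => sg (X ω, Y ω)) E := by
    intro E hE hs
    rw [Measure.map_apply hm hE]
    have hsub : X ⁻¹' E ∩ Y ⁻¹' {false} ⊆ (fun ω => sg (X ω, Y ω)) ⁻¹' E := by
      rintro ω ⟨h1, h2⟩
      have h2 : Y ω = false := h2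
      simpa [sg, h2] using h1
    refine le_trans (le_of_eq ?_) (measure_mono hsub)
    rw [hi.measure_inter_preimage_eq_mul _ _ hE (measurableSet_singleton _), hYv,
      ← Measure.map_apply hX hE, lX, uniformIcc_apply b E hE, Set.inter_eq_left.2 hs, mul_comm]
  have hneg : ∀ E : Set ℝ, MeasurableSet E → E ⊆ Set.Icc (-(b+1)) (-b) →
      ENNReal.ofReal (1/2) * volume E ≤ P.map (fun ω => sg (X ω, Y ω)) E := by
    intro E hE hs
    rw [Measure.map_apply hm hE]
    have hsub : X ⁻¹' (-E) ∩ Y ⁻¹' {true} ⊆ (fun ω => sg (X ω, Y ω)) ⁻¹' E := by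
      rintro ω ⟨h1, h2⟩
      have h2 : Y ω = true := h2
      simpa [sg, h2] using h1
    have hs' : -E ⊆ Set.Icc b (b + 1) := fun x hx => by
      have := hs (Set.mem_neg.1 hx)
      constructor <;> linarith [this.1, this.2]
    refine le_trans (le_of_eq ?_) (measure_mono hsub)
    rw [hi.measure_inter_preimage_eq_mul _ _ hE.neg (measurableSet_singleton _), hYv,
      ← Measure.map_apply hX hE.neg, lX, uniformIcc_apply b _ hE.neg, Set.inter_eq_left.2 hs', mul_comm,
      Measure.measure_neg]
  have hXae : ∀ᵐ ω ∂P, X ω ∈ Set.Icc b (b + 1) := by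
    have : ∀ᵐ x ∂(P.map X), x ∈ Set.Icc b (b + 1) := by
      rw [lX, ae_iff]
      have e : {a | a ∉ Set.Icc b (b+1)} = (Set.Icc b (b+1))ᶜ := rfl
      rw [e, uniformIcc_apply _ _ measurableSet_Icc.compl]
      simp
    exact ae_of_ae_map hX.aemeasurable this
  refine ⟨?_, ?_, ?_, ?_⟩
  · filter_upwards [hXae] with ω h
    have : |sg (X ω, Y ω)| = |X ω| := by
      unfold sg; split_ifs <;> simp
    rw [this, abs_le]
    constructor <;> linarith [h.1, h.2, neg_abs_le b, le_abs_self b]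
  · have hε : Measurable (fun ω => (if Y ω then (-1 : ℝ) else 1)) :=
      (measurable_of_countable (fun c : Bool => if c then (-1 : ℝ) else 1)).comp hY
    have hi' : IndepFun X (fun ω => (if Y ω then (-1 : ℝ) else 1)) P :=
      hi.comp (φ := id) (ψ := fun c : Bool => if c then (-1 : ℝ) else 1) measurable_id (measurable_of_countable _)
    have e : (fun ω => sg (X ω, Y ω)) = fun ω => X ω * (if Y ω then (-1 : ℝ) else 1) := by
      funext ω; unfold sg; split_ifs <;> simp
    rw [e, hi'.integral_fun_mul_eq_mul_integral hX.aestronglyMeasurable hε.aestronglyMeasurable]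
    have : ∫ ω, (if Y ω then (-1 : ℝ) else 1) ∂P = 0 := by
      have h1 : ∫ ω, (if Y ω then (-1 : ℝ) else 1) ∂P = ∫ c, (if c then (-1 : ℝ) else 1) ∂(P.map Y) := by
        rw [integral_map hY.aemeasurable (measurable_of_countable _).aestronglyMeasurable]
      rw [h1, lY, PMF.integral_eq_sum]
      simp
    rw [this, mul_zero]
  · intro E hE hs
    rcases le_total b (-b-1) with h | h
    · rw [max_eq_right h] at hs
      exact hneg E hE (hs.trans (Set.Icc_subset_Icc (by linarith) (by linarith)))
    · rw [max_eq_left h] at hs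
      exact hpos E hE hs
  · intro E hE hs
    rcases le_total b (-b-1) with h | h
    · rw [max_eq_right h] at hs
      exact hpos E hE (hs.trans (Set.Icc_subset_Icc (by linarith) (by linarith)))
    · rw [max_eq_left h] at hs
      exact hneg E hE hs

noncomputable def Xw {k m : ℕ} {Ω : Type} (X : (HGraph k m).edgeSet → Ω → ℝ) (ω : Ω) : Sym2 (HV k m) → ℝ :=
  fun e => if h : e ∈ (HGraph k m).edgeSet then X ⟨e, h⟩ ω else 0

noncomputable def ss {k m : ℕ} {Ω : Type} (X : (HGraph k m).edgeSet → Ω → ℝ) (σb : Ω → (HV k m → Bool))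
    (x : NI k m) (ω : Ω) : ℝ := sv (Xw X ω) (toCut (σb ω)) x

lemma setup (b : ℝ) {k m : ℕ} {Ω : Type} [MeasurableSpace Ω] (P : Measure Ω) [IsProbabilityMeasure P]
    [Fintype (HV k m → Bool)]
    (X : (HGraph k m).edgeSet → Ω → ℝ) (σb : Ω → (HV k m → Bool))
    (hX : ∀ e, Measurable (X e)) (iX : iIndepFun X P)
    (lX : ∀ e, Measure.map (X e) P = uniformIcc b (b + 1))
    (hσ : Measurable σb)
    (lσ : Measure.map σb P = (PMF.uniformOfFintype (HV k m → Bool)).toMeasure)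
    (hi : IndepFun (fun ω e => X e ω) σb P) :
    (∀ x, Measurable (ss X σb x)) ∧ iIndepFun (ss X σb) P ∧ ∀ x, 
    ((∀ᵐ ω ∂P, |ss X σb x ω| ≤ |b| + 1) ∧ ∫ ω, ss X σb x ω ∂P = 0 ∧
    (∀ E : Set ℝ, MeasurableSet E → E ⊆ Set.Icc (max b (-b-1)) (max b (-b-1) + 1) →
      ENNReal.ofReal (1/2) * volume E ≤ P.map (ss X σb x) E) ∧
    (∀ E : Set ℝ, MeasurableSet E → E ⊆ Set.Icc (-(max b (-b-1) + 1)) (-max b (-b-1)) →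
      ENNReal.ofReal (1/2) * volume E ≤ P.map (ss X σb x) E)) := by
  set X' : NI k m → Ω → ℝ := fun x => X ⟨edg x, edg_mem x⟩ with hX'
  set Y : NI k m → Ω → Bool := fun x ω => tau (σb ω) (vtx x) with hY
  have htau : Measurable (tau : (HV k m → Bool) → HV k m → Bool) := measurable_of_countable _
  have hYm : ∀ x, Measurable (Y x) := fun x => (measurable_pi_apply (vtx x)).comp (htau.comp hσ)
  have hτσ : Measurable (fun ω => tau (σb ω)) := htau.comp hσ
  have hτv : ∀ v, Measurable (fun ω => tau (σb ω) v) := fun v => (measurable_pi_apply v).comp hτσ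
  have hss : ∀ x, ss X σb x = fun ω => sg (X' x ω, Y x ω) := by
    intro x; funext ω
    rw [ss, sg_eq]
    simp [Xw, edg_mem, hX', hY]
  have lτ : P.map (fun ω => tau (σb ω)) = Measure.pi (fun _ : HV k m => (PMF.uniformOfFintype Bool).toMeasure) := by
    have : P.map (fun ω => tau (σb ω)) = (P.map σb).map tau := by
      rw [Measure.map_map htau hσ]; rfl
    rw [this, lσ, uniform_map_inj _ tau_inj, uniform_pi]
  have lτ1 : ∀ v, P.map (fun ω => tau (σb ω) v) = (PMF.uniformOfFintype Bool).toMeasure := by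
    intro v
    have : P.map (fun ω => tau (σb ω) v) = (P.map (fun ω => tau (σb ω))).map (Function.eval v) := by
      have a1 : Measurable (Function.eval v : (HV k m → Bool) → Bool) := measurable_pi_apply v
      rw [Measure.map_map a1 hτσ]; rfl
    rw [this, lτ]
    exact (measurePreserving_eval (fun _ : HV k m => (PMF.uniformOfFintype Bool).toMeasure) v).map_eq
  have iτ : iIndepFun (fun v ω => tau (σb ω) v) P := by
    rw [iIndepFun_iff_map_fun_eq_pi_map (fun v => (hτv v).aemeasurable)]
    simp only [lτ1]
    exact lτ
  have vinj : Function.Injective (vtx : NI k m → HV k m) := by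
    rintro ⟨i, s, x⟩ ⟨i', s', x'⟩ h
    simpa [vtx] using h
  have iY : iIndepFun Y P := iτ.precomp (g := vtx) vinj
  have iX' : iIndepFun X' P := iX.precomp (g := fun x : NI k m => (⟨edg x, edg_mem x⟩ : (HGraph k m).edgeSet))
    (fun a b h => edg_inj (by simpa using h))
  have hXY : IndepFun (fun ω x => X' x ω) (fun ω x => Y x ω) P :=
    hi.comp (φ := fun f (x : NI k m) => f ⟨edg x, edg_mem x⟩) (ψ := fun σ (x : NI k m) => tau σ (vtx x))
      (measurable_pi_lambda _ (fun x => measurable_pi_apply _)) (measurable_of_countable _)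
  have hz := indep_zip P X' Y (fun x => hX _) hYm iX' iY hXY
  refine ⟨?_, ?_, ?_⟩
  · intro x
    rw [hss]
    exact sg_meas.comp ((hX _).prodMk (hYm x))
  · have : ss X σb = fun x ω => sg (X' x ω, Y x ω) := funext hss
    rw [this]
    exact hz.comp (fun _ => sg) (fun _ => sg_meas)
  · intro x
    rw [hss x]
    refine sg_laws P b (X' x) (Y x) (hX _) (hYm x) ?_ (lX _) (lτ1 _)
    have a1 : Measurable (fun f : NI k m → ℝ => f x) := measurable_pi_apply x
    have a2 : Measurable (fun f : NI k m → Bool => f x) := measurable_pi_apply x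
    exact hXY.comp a1 a2

-- BEGIN P6
def eqv (T : ℕ) : Fin 2 × (Fin 2 × Fin T) ≃ Fin (2 * (2 * T)) :=
  (Equiv.prodCongr (Equiv.refl _) finProdFinEquiv).trans finProdFinEquiv

def idx {k T : ℕ} (i : Fin k) (s : Fin 2) (z : (Fin 2 × Fin T) × (Fin 2 × Fin 2)) : NI k (2 * T) :=
  if z.2.2 = 0 then mid (i, s, eqv T (z.2.1, z.1)) else pen (i, s, eqv T (z.2.1, z.1))

lemma idx_inj {k T : ℕ} (i : Fin k) (s : Fin 2) : Function.Injective (idx (T := T) i s) := by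
  rintro ⟨q, r, t⟩ ⟨q', r', t'⟩ h
  fin_cases t <;> fin_cases t' <;> simp [idx, mid, pen] at h ⊢ <;> exact ⟨h.2, h.1⟩

lemma det_tree {k T : ℕ} (X : Sym2 (HV k (2 * T)) → ℝ) (σ : HV k (2 * T) → ℝ) (t : Fin k → ℝ) (δ : ℝ)
    (h : ∀ (i : Fin k) (s : Fin 2), ∃ S : Finset (Fin 2 × Fin T),
      |∑ q, (sv X σ (idx i s (q, (0, 0))) + sv X σ (idx i s (q, (1, 0)))) +
        ∑ q ∈ S, pairD (fun p => sv X σ (idx i s (q, p))) - t i| ≤ δ) :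
    ∃ L : List (Finset (HV k (2 * T))), (∀ S ∈ L, S.card ≤ 3) ∧ Improving (HGraph k (2 * T)) X σ L ∧
      (∀ S ∈ L, ∀ x ∈ S, x.2.2 ≠ Sum.inl ()) ∧
      ∀ i s, |impr (HGraph k (2 * T)) X (applyList σ L) {center k (2 * T) i s} - t i| ≤ δ := by
  choose S hS using h
  set act : Fin k → Fin 2 → Fin 2 × Fin T → Prop := fun i s q =>
    0 < sv X σ (idx i s (q, (0, 0))) + sv X σ (idx i s (q, (0, 1))) ∧
    0 < sv X σ (idx i s (q, (1, 0))) + sv X σ (idx i s (q, (1, 1))) with hact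
  obtain ⟨L, h1, h2, h3, h4⟩ := det_final X σ
    (Finset.univ.filter (fun a : MI k (2 * T) => ((eqv T).symm a.2.2).2 ∈ S a.1 a.2.1 ∧
      act a.1 a.2.1 ((eqv T).symm a.2.2).2)) (by
    rintro ⟨i, s, j⟩ ha
    obtain ⟨⟨r, q⟩, rfl⟩ := (eqv T).surjective j
    simp only [Finset.mem_filter, Finset.mem_univ, true_and, Equiv.symm_apply_apply] at ha
    obtain ⟨_, ha1, ha2⟩ := ha
    fin_cases r
    · exact ha1
    · exact ha2)
  refine ⟨L, h1, h2, h3, fun i s => ?_⟩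
  rw [h4]
  refine le_trans (le_of_eq ?_) (hS i s)
  congr 2
  rw [← (eqv T).sum_comp, Fintype.sum_prod_type, Fin.sum_univ_two, ← Finset.sum_add_distrib,
    ← Finset.sum_filter_add_sum_filter_not Finset.univ (fun q => q ∈ S i s)]
  rw [← Finset.sum_filter_add_sum_filter_not Finset.univ (fun q => q ∈ S i s)
    (fun q => (sv X σ (idx i s (q, (0, 0))) + sv X σ (idx i s (q, (1, 0)))))]
  have e : Finset.univ.filter (fun q => q ∈ S i s) = S i s := by ext; simp
  rw [e, add_right_comm, ← Finset.sum_add_distrib]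
  congr 1
  · refine Finset.sum_congr rfl (fun q hq => ?_)
    simp only [Finset.mem_filter, Finset.mem_univ, true_and, Equiv.symm_apply_apply, hq, pairD]
    by_cases ha : act i s q
    · rw [if_pos ha, if_pos ha, if_pos ha]
      simp [idx]; ring
    · rw [if_neg ha, if_neg ha, if_neg ha]
      simp [idx]
  · refine Finset.sum_congr rfl (fun q hq => ?_)
    have hq' : q ∉ S i s := by simpa using hq
    simp [hq', idx]

lemma tree_fail (b : ℝ) {k T : ℕ} {Ω : Type} [MeasurableSpace Ω] (P : Measure Ω) [IsProbabilityMeasure P]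
    (η : ℝ) (hη : 0 < η) (hηw : η ≤ 1/32) (hT : 8 ≤ (T:ℝ) * (1/4096 * (1/32)^2))
    (s : NI k (2 * T) → Ω → ℝ) (hs : ∀ x, Measurable (s x)) (hi : iIndepFun s P)
    (hl : ∀ x, ((∀ᵐ ω ∂P, |s x ω| ≤ |b| + 1) ∧ ∫ ω, s x ω ∂P = 0 ∧
    (∀ E : Set ℝ, MeasurableSet E → E ⊆ Set.Icc (max b (-b-1)) (max b (-b-1) + 1) →
      ENNReal.ofReal (1/2) * volume E ≤ P.map (s x) E) ∧
    (∀ E : Set ℝ, MeasurableSet E → E ⊆ Set.Icc (-(max b (-b-1) + 1)) (-max b (-b-1)) →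
      ENNReal.ofReal (1/2) * volume E ≤ P.map (s x) E))) (i : Fin k) (c : Fin 2) :
    P {ω | ¬ ∀ t ∈ Set.Icc (0:ℝ) 1, ∃ S : Finset (Fin 2 × Fin T), 
        |∑ q, (s (idx i c (q, (0, 0))) ω + s (idx i c (q, (1, 0))) ω) +
          ∑ q ∈ S, pairD (fun p => s (idx i c (q, p)) ω) - t| ≤ 2 * η} ≤
      ENNReal.ofReal (2 * (1/32) ^ 2 / η ^ 2 * (1 - 1/4096 * (1/32)) ^ T) + 
      (ENNReal.ofReal (Real.exp (-(1/4096 * (1/32)^2 / 8 / (2 * (2 * (|b| + 1) + 1/32))) ^ 2 * T)) +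
      ENNReal.ofReal (Real.exp (-(1/4096 * (1/32)^2 / 8 / (2 * (2 * (|b| + 1) + 1/32))) ^ 2 * T))) := by
  have hi' : iIndepFun (fun z ω => s (idx (T := T) i c z) ω) P := hi.precomp (g := idx i c) (idx_inj i c)
  have hc := indep_curry P (fun z ω => s (idx (T := T) i c z) ω) (fun z => hs _) hi'
  have hint : ∀ x, Integrable (s x) P := fun x =>
    Integrable.of_bound (hs x).aestronglyMeasurable (|b| + 1) (by
      filter_upwards [(hl x).1] with ω h; simpa using h)
  have hDm : ∀ q, Measurable (fun ω => pairD (fun p => s (idx (T := T) i c (q, p)) ω)) := fun q =>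
    pairD_meas.comp (measurable_pi_lambda _ (fun p => hs _))
  have hμ : ∀ q : Fin 2 × Fin T, ∀ E : Set ℝ, MeasurableSet E → E ⊆ Set.Icc (-(2*(1/32))) (2*(1/32)) →
      ENNReal.ofReal (1/4096) * volume E ≤ (P.map (fun ω => pairD (fun p => s (idx i c (q, p)) ω))) E := by
    intro q E hE hEs
    refine pair_minor P (fun p => s (idx i c (q, p))) (fun p => hs _) ?_ (max b (-b-1)) ?_ 
      (fun p => (hl _).2.2.1) (fun p => (hl _).2.2.2) E hE hEs
    · exact hi'.precomp (g := fun p => (q, p)) (fun a b h => by simpa using h)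
    · rcases le_total b (-b-1) with h | h
      · rw [max_eq_right h]; linarith
      · rw [max_eq_left h]; linarith
  refine tree_prob P (w := 1/32) (c0 := 1/4096) (η := η) (M := 2 * (|b| + 1)) (by norm_num) (by norm_num)
    (by norm_num) hη hηw (by positivity) T hT
    (fun q ω => pairD (fun p => s (idx i c (q, p)) ω))
    (fun q ω => s (idx i c (q, (0, 0))) ω + s (idx i c (q, (1, 0))) ω) hDm
    (fun q => (hs _).add (hs _)) ?_ ?_ ?_ hμ (fun q => minor_neg P _ (hDm q) (hμ q))
  · have hg : Measurable (fun x : Fin 2 × Fin 2 → ℝ => (pairD x, x (0, 0) + x (1, 0))) :=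
      pairD_meas.prodMk (by fun_prop)
    exact hc.comp (fun _ x => (pairD x, x (0, 0) + x (1, 0))) (fun _ => hg)
  · intro q
    filter_upwards [(hl (idx i c (q, (0, 0)))).1, (hl (idx i c (q, (1, 0)))).1] with ω h1 h2
    exact (abs_add_le _ _).trans (by linarith)
  · intro q
    rw [integral_add (hint _) (hint _), (hl _).2.1, (hl _).2.1, add_zero]

-- BEGIN P7
lemma lim_bound (r : ℝ) (h0 : 0 ≤ r) (h1 : r < 1) (ε : ℝ) (hε : 0 < ε) :
    ∃ K : ℕ, ∀ k : ℕ, K ≤ k → 2 * (k:ℝ) * (18/1024 * (1/2)^k + (r^k + r^k)) ≤ ε := by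
  have a := tendsto_self_mul_const_pow_of_lt_one (r := (1/2:ℝ)) (by norm_num) (by norm_num)
  have c := tendsto_self_mul_const_pow_of_lt_one h0 h1
  have d := (a.const_mul (2 * (18/1024))).add (c.const_mul 4)
  simp only [mul_zero, add_zero] at d
  have := (d.eventually (gt_mem_nhds hε))
  obtain ⟨K, hK⟩ := Filter.eventually_atTop.1 this
  exact ⟨K, fun k hk => by have := hK k hk; linarith⟩

/-- For every real `b` there is `C > 0` such that for every `ε > 0` and all
sufficiently large `k` there is `m ≤ C·k` such that for the graph `H_{k,m}` with independent
uniform `[b, b+1]` edge weights and an independent uniformly random cut `σ`, with probability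
at least `1 − ε` there is an improving 3-flip sequence `L` moving no center vertex with
`|impr_{σ^L}(u) − 3^{−(i−1)}| < 3^{−k}` for all `i ∈ [k]`, `u ∈ {v_i, w_i}` (here `i : Fin k`
is zero-based). -/
theorem three_flip_controlled_improvements (b : ℝ) :
    ∃ C : ℝ, 0 < C ∧ ∀ ε : ℝ, 0 < ε → ∃ K : ℕ, ∀ k : ℕ, K ≤ k →
      ∃ m : ℕ, (m : ℝ) ≤ C * k ∧
        ∀ (Ω : Type) (_ : MeasurableSpace Ω) (P : Measure Ω), IsProbabilityMeasure P →
          ∀ (X : (HGraph k m).edgeSet → Ω → ℝ) (σb : Ω → (HV k m → Bool)),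
            (∀ e, Measurable (X e)) →
            iIndepFun X P →
            (∀ e, Measure.map (X e) P = uniformIcc b (b + 1)) →
            Measurable σb →
            Measure.map σb P = (PMF.uniformOfFintype (HV k m → Bool)).toMeasure →
            IndepFun (fun ω e => X e ω) σb P →
            ENNReal.ofReal (1 - ε) ≤
              P {ω | ∃ L : List (Finset (HV k m)),
                (∀ S ∈ L, S.card ≤ 3) ∧
                Improving (HGraph k m)
                  (fun e => if h : e ∈ (HGraph k m).edgeSet then X ⟨e, h⟩ ω else 0)
                  (toCut (σb ω)) L ∧
                (∀ S ∈ L, ∀ x ∈ S, x.2.2 ≠ Sum.inl ()) ∧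
                ∀ i : Fin k, ∀ u ∈ ({center k m i 0, center k m i 1} : Set (HV k m)),
                  |impr (HGraph k m)
                      (fun e => if h : e ∈ (HGraph k m).edgeSet then X ⟨e, h⟩ ω else 0)
                      (applyList (toCut (σb ω)) L) {u} - (3 : ℝ) ^ (-(i : ℤ))| <
                    (3 : ℝ) ^ (-(k : ℤ))} := by
  obtain ⟨n, hn⟩ := exists_pow_lt_of_lt_one (show (0:ℝ) < 1/18 by norm_num)
    (show (1 - 1/4096 * (1/32) : ℝ) < 1 by norm_num)
  have hn0 : 1 ≤ n := by
    rcases Nat.eq_zero_or_pos n with h | h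
    · subst h; norm_num at hn
    · exact h
  have hn1 : (1:ℝ) ≤ n := by exact_mod_cast hn0
  obtain ⟨c1, hc1⟩ : ∃ c1 : ℝ, c1 = (1/4096 * (1/32)^2 / 8 / (2 * (2 * (|b| + 1) + 1/32))) ^ 2 := ⟨_, rfl⟩
  have hc1p : 0 < c1 := by rw [hc1]; positivity
  refine ⟨2 * n, by linarith, fun ε hε => ?_⟩
  obtain ⟨K, hK⟩ := lim_bound (Real.exp (-c1 * n)) (Real.exp_pos _).le
    (by rw [Real.exp_lt_one_iff]; nlinarith) ε hε
  refine ⟨max K 33554432, fun k hk => ⟨2 * (n * k), by push_cast; linarith, ?_⟩⟩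
  have hkK : K ≤ k := (le_max_left _ _).trans hk
  have hk2 : 33554432 ≤ k := (le_max_right _ _).trans hk
  have hk3 : (33554432:ℝ) ≤ k := by exact_mod_cast hk2
  have hF := hK k hkK
  intro Ω mΩ P hP X σb hX iX lX hσ lσ hi
  obtain ⟨s1, s2, s3⟩ := setup b P X σb hX iX lX hσ lσ hi
  obtain ⟨η, hη⟩ : ∃ η : ℝ, η = (3:ℝ) ^ (-(k:ℤ)) / 3 := ⟨_, rfl⟩
  have h3k : (0:ℝ) < (3:ℝ) ^ (-(k:ℤ)) := by positivity
  have hη0 : 0 < η := by rw [hη]; positivity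
  have hηw : η ≤ 1/32 := by
    have : (3:ℝ) ^ (-(k:ℤ)) ≤ (3:ℝ) ^ (-(3:ℤ)) := zpow_le_zpow_right₀ (by norm_num) (by omega)
    rw [hη]; norm_num at this ⊢; linarith
  have hT : 8 ≤ ((n * k : ℕ):ℝ) * (1/4096 * (1/32)^2) := by
    push_cast
    have : (k:ℝ) ≤ n * k := le_mul_of_one_le_left (by positivity) hn1
    norm_num; linarith
  have hbad := fun i c => tree_fail b P η hη0 hηw hT (ss X σb) s1 s2 s3 i c
  obtain ⟨B, hB⟩ : ∃ B : Fin k × Fin 2 → Set Ω, B = fun z =>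
    {ω | ¬ ∀ t ∈ Set.Icc (0:ℝ) 1, ∃ S : Finset (Fin 2 × Fin (n * k)),
        |∑ q, (ss X σb (idx z.1 z.2 (q, (0, 0))) ω + ss X σb (idx z.1 z.2 (q, (1, 0))) ω) +
          ∑ q ∈ S, pairD (fun p => ss X σb (idx z.1 z.2 (q, p)) ω) - t| ≤ 2 * η} := ⟨_, rfl⟩
  have hBz : ∀ z, P (B z) ≤ ENNReal.ofReal (18/1024 * (1/2)^k +
      (Real.exp (-c1 * n) ^ k + Real.exp (-c1 * n) ^ k)) := by
    intro z
    rw [hB]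
    refine (hbad z.1 z.2).trans ?_
    rw [← hc1, ← ENNReal.ofReal_add (by positivity) (by positivity),
      ← ENNReal.ofReal_add (mul_nonneg (by positivity) (pow_nonneg (by norm_num) _)) (by positivity)]
    apply ENNReal.ofReal_le_ofReal
    have e1 : Real.exp (-c1 * ((n * k : ℕ):ℝ)) = Real.exp (-c1 * n) ^ k := by
      rw [← Real.exp_nat_mul]; congr 1; push_cast; ring
    rw [e1]
    have e2 : (2:ℝ) * (1/32)^2 / η^2 = 18/1024 * 9^k := by
      have : (9:ℝ)^k = (3:ℝ)^k * (3:ℝ)^k := by rw [← mul_pow]; norm_num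
      rw [hη, this, zpow_neg, zpow_natCast]
      field_simp
      norm_num
    have e3 : (1 - 1/4096 * (1/32) : ℝ) ^ (n * k) ≤ (1/18)^k := by
      rw [pow_mul]
      exact pow_le_pow_left₀ (pow_nonneg (by norm_num) _) hn.le _
    have e4 : (9:ℝ)^k * (1/18)^k = (1/2)^k := by rw [← mul_pow]; norm_num
    have e5 : (18/1024:ℝ) * 9^k * (1 - 1/4096 * (1/32) : ℝ) ^ (n * k) ≤ 18/1024 * (1/2)^k := by
      rw [← e4, mul_assoc]
      gcongr
    rw [e2]
    linarith
  have hU : P (⋃ z, B z) ≤ ENNReal.ofReal ε := by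
    refine (measure_iUnion_fintype_le P B).trans ((Finset.sum_le_sum (fun z _ => hBz z)).trans ?_)
    rw [Finset.sum_const, Finset.card_univ, Fintype.card_prod, Fintype.card_fin, Fintype.card_fin,
      ← ENNReal.ofReal_nsmul]
    apply ENNReal.ofReal_le_ofReal
    rw [nsmul_eq_mul]
    push_cast
    linarith
  rw [ENNReal.ofReal_sub _ hε.le, ENNReal.ofReal_one, tsub_le_iff_right]
  refine le_trans ?_ (add_le_add le_rfl hU)
  refine le_trans ?_ (measure_union_le _ _)
  rw [← measure_univ (μ := P)]
  refine measure_mono (fun ω _ => ?_)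
  by_cases hω : ω ∈ ⋃ z, B z
  · exact Or.inr hω
  left
  have hgood : ∀ (i : Fin k) (c : Fin 2), ∃ S : Finset (Fin 2 × Fin (n * k)),
        |∑ q, (sv (Xw X ω) (toCut (σb ω)) (idx i c (q, (0, 0))) +
            sv (Xw X ω) (toCut (σb ω)) (idx i c (q, (1, 0)))) +
          ∑ q ∈ S, pairD (fun p => sv (Xw X ω) (toCut (σb ω)) (idx i c (q, p))) -
            (3:ℝ) ^ (-(i:ℤ))| ≤ 2 * η := by
    intro i c
    have h1 : ω ∉ B (i, c) := fun h => hω (Set.mem_iUnion.2 ⟨_, h⟩)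
    rw [hB] at h1
    simp only [Set.mem_ofPred_eq, not_not] at h1
    exact h1 _ ⟨by positivity, zpow_le_one_of_nonpos₀ (by norm_num) (by omega)⟩
  obtain ⟨L, l1, l2, l3, l4⟩ := det_tree (Xw X ω) (toCut (σb ω)) (fun i => (3:ℝ) ^ (-(i:ℤ))) (2 * η) hgood
  have hlt : 2 * η < (3:ℝ) ^ (-(k:ℤ)) := by rw [hη]; linarith
  refine ⟨L, l1, l2, l3, ?_⟩
  intro i u hu
  rcases hu with rfl | rfl
  · exact (l4 i 0).trans_lt hlt
  · exact (l4 i 1).trans_lt hlt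


end MaxCut
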